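/- arXiv:2004.00115 — 9 statements merged into one kernel-verified Lean document; each statement's English description precedes it below -/
import Mathlib

section
/- Let m ≥ 1, let α : Fin m → ℝ with α j > 0 for every j, |α| := ∑_j α j, and let h ≥ 0 be a real number. Let f : ℝ^m → ℝ be measurable, homogeneous of degree h (i.e. f(t·θ) = t^h · f(θ) for all t > 0 and all θ ∈ (0,∞)^m), and integrable with respect to the product Gamma density ∏_{j=1}^m θ_j^{α_j−1} e^{−θ_j} / Γ(α_j) on (0,∞)^m. Then E_{Dir(α)}[f] = (Γ(|α|) / Γ(|α| + h)) · ∫_{(0,∞)^m} f(θ) · ∏_{j=1}^m θ_j^{α_j−1} e^{−θ_j} / Γ(α_j) dθ. -/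
open MeasureTheory Real Finset

/-- The map sending `x ∈ ℝ^{m-1}` to the point `θ` of the simplex in `ℝ^m` with
`θ_j = x_j` for `j < m-1` and `θ_m = 1 - ∑ x_j`. -/
noncomputable def coordMap (m : ℕ) (x : Fin (m - 1) → ℝ) : Fin m → ℝ :=
  fun j => if hj : (j : ℕ) < m - 1 then x ⟨(j : ℕ), hj⟩ else 1 - ∑ j', x j'

/-- The domain `{x ∈ ℝ^{m-1} : x_j ≥ 0, ∑ x_j ≤ 1}` realizing the simplex. -/
def simplexDom (m : ℕ) : Set (Fin (m - 1) → ℝ) :=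
  {x | (∀ j, 0 ≤ x j) ∧ ∑ j, x j ≤ 1}

/-- The Dirichlet(α) expectation of `g`, realized as a Lebesgue integral over
`{x ∈ ℝ^{m-1} : x_j ≥ 0, ∑ x_j ≤ 1}`. -/
noncomputable def dirExp (m : ℕ) (α : Fin m → ℝ) (g : (Fin m → ℝ) → ℝ) : ℝ :=
  ∫ x in simplexDom m,
    g (coordMap m x) * (∏ j, (coordMap m x) j ^ (α j - 1)) /
      ((∏ j, Real.Gamma (α j)) / Real.Gamma (∑ j, α j))

noncomputable def cMap (n : ℕ) (x : Fin n → ℝ) (s : ℝ) : Fin (n + 1) → ℝ :=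
  (Fin.last n).insertNth (α := fun _ => ℝ) (s - ∑ i, x i) x

lemma cMap_castSucc (n : ℕ) (x : Fin n → ℝ) (s : ℝ) (i : Fin n) :
    cMap n x s i.castSucc = x i := by
  simp [cMap]

lemma cMap_last (n : ℕ) (x : Fin n → ℝ) (s : ℝ) :
    cMap n x s (Fin.last n) = s - ∑ i, x i := by
  simp [cMap]

lemma coordMap_eq (n : ℕ) (x : Fin n → ℝ) : coordMap (n + 1) x = cMap n x 1 := by
  funext j
  refine Fin.lastCases ?_ (fun i => ?_) j
  · rw [cMap_last]; simp [coordMap]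
  · rw [cMap_castSucc]; simp [coordMap]

lemma cMap_smul (n : ℕ) (x : Fin n → ℝ) (s : ℝ) : cMap n (s • x) s = s • cMap n x 1 := by
  funext j
  refine Fin.lastCases ?_ (fun i => ?_) j
  · simp only [Pi.smul_apply, cMap_last, smul_eq_mul, ← Finset.mul_sum]; ring
  · simp [cMap_castSucc]

lemma sum_cMap (n : ℕ) (x : Fin n → ℝ) (s : ℝ) : ∑ j, cMap n x s j = s := by
  rw [Fin.sum_univ_castSucc]; simp [cMap_castSucc, cMap_last]

noncomputable def shearEquiv (n : ℕ) : (Fin n → ℝ) × ℝ ≃ᵐ (Fin n → ℝ) × ℝ where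
  toFun p := (p.1, p.2 - ∑ i, p.1 i)
  invFun p := (p.1, p.2 + ∑ i, p.1 i)
  left_inv p := by simp
  right_inv p := by simp
  measurable_toFun := by
    change Measurable (fun p : (Fin n → ℝ) × ℝ => (p.1, p.2 - ∑ i, p.1 i))
    fun_prop
  measurable_invFun := by
    change Measurable (fun p : (Fin n → ℝ) × ℝ => (p.1, p.2 + ∑ i, p.1 i))
    fun_prop

lemma shear_mp (n : ℕ) : MeasurePreserving (shearEquiv n) volume volume := by
  have := MeasurePreserving.skew_product (μa := (volume : Measure (Fin n → ℝ)))
    (μb := (volume : Measure (Fin n → ℝ))) (μc := (volume : Measure ℝ))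
    (μd := (volume : Measure ℝ)) (f := id)
    (MeasurePreserving.id _) (g := fun y s => s - ∑ i, y i) (by fun_prop)
    (Filter.Eventually.of_forall fun y => (measurePreserving_sub_right volume (∑ i, y i)).map_eq)
  exact this

noncomputable def cEquiv (n : ℕ) : (Fin n → ℝ) × ℝ ≃ᵐ (Fin (n + 1) → ℝ) :=
  ((shearEquiv n).trans MeasurableEquiv.prodComm).trans
    (MeasurableEquiv.piFinSuccAbove (fun _ => ℝ) (Fin.last n)).symm

lemma cEquiv_mp (n : ℕ) : MeasurePreserving (cEquiv n) volume volume := by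
  have h1 := (volume_preserving_piFinSuccAbove (fun _ : Fin (n + 1) => ℝ) (Fin.last n)).symm
  have h2 : MeasurePreserving (Prod.swap : (Fin n → ℝ) × ℝ → ℝ × (Fin n → ℝ)) volume volume :=
    Measure.measurePreserving_swap
  exact h1.comp (h2.comp (shear_mp n))

lemma cEquiv_apply (n : ℕ) (x : Fin n → ℝ) (s : ℝ) : cEquiv n (x, s) = cMap n x s := rfl

lemma null_sum (n : ℕ) : ∀ᵐ x : Fin n → ℝ, ∑ i, x i ≠ 1 := by
  let S : AffineSubspace ℝ (Fin n → ℝ) :=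
    { carrier := {x | ∑ i, x i = 1}
      smul_vsub_vadd_mem' := by
        intro c p1 p2 p3 h1 h2 h3
        simp only [Set.mem_ofPred_eq] at *
        simp [Finset.sum_add_distrib, ← Finset.mul_sum, h1, h2, h3] }
  have hS : S ≠ ⊤ := by
    intro h
    have : (0 : Fin n → ℝ) ∈ S := by rw [h]; trivial
    have h2 : ∑ i : Fin n, (0 : Fin n → ℝ) i = 1 := this
    simp at h2
  have := Measure.addHaar_affineSubspace (volume : Measure (Fin n → ℝ)) S hS
  rw [ae_iff]
  have e : {a : Fin n → ℝ | ¬ ∑ i, a i ≠ 1} = (S : Set (Fin n → ℝ)) := by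
    ext a
    rw [Set.mem_ofPred_eq, not_not]
    exact Iff.rfl
  rw [e]
  exact this

lemma null_coord (n : ℕ) : ∀ᵐ x : Fin n → ℝ, ∀ i, x i ≠ 0 := by
  rw [ae_all_iff]
  intro i
  rw [ae_iff]
  simp only [ne_eq, not_not]
  exact Measure.pi_hyperplane (fun _ : Fin n => (volume : Measure ℝ)) i 0

lemma simplex_ae (n : ℕ) :
    simplexDom (n + 1) =ᵐ[(volume : Measure (Fin n → ℝ))] {x | ∀ j, 0 < cMap n x 1 j} := by
  filter_upwards [null_sum n, null_coord n] with x h1 h2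
  apply propext
  change ((∀ j, 0 ≤ x j) ∧ ∑ j, x j ≤ 1) ↔ ∀ j, 0 < cMap n x 1 j
  rw [Fin.forall_fin_succ']
  simp only [cMap_castSucc, cMap_last, sub_pos]
  constructor
  · rintro ⟨a, b⟩
    exact ⟨fun i => lt_of_le_of_ne (a i) (h2 i).symm, lt_of_le_of_ne b h1⟩
  · rintro ⟨a, b⟩
    exact ⟨fun i => (a i).le, b.le⟩

lemma pos_meas (n : ℕ) : MeasurableSet {θ : Fin n → ℝ | ∀ j, 0 < θ j} := by
  have : {θ : Fin n → ℝ | ∀ j, 0 < θ j} = ⋂ j, {θ | 0 < θ j} := by ext; simp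
  rw [this]
  exact MeasurableSet.iInter fun j => measurableSet_lt measurable_const (measurable_pi_apply j)

theorem dirichlet_gamma (m : ℕ) (hm : 1 ≤ m) (α : Fin m → ℝ) (hα : ∀ j, 0 < α j)
    (h : ℝ) (hh : 0 ≤ h)
    (f : (Fin m → ℝ) → ℝ) (hf_meas : Measurable f)
    (hf_hom : ∀ t : ℝ, 0 < t → ∀ θ : Fin m → ℝ, (∀ j, 0 < θ j) →
      f (t • θ) = t ^ h * f θ)
    (hf_int : IntegrableOn
      (fun θ : Fin m → ℝ =>
        f θ * ∏ j, θ j ^ (α j - 1) * Real.exp (-θ j) / Real.Gamma (α j))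
      {θ | ∀ j, 0 < θ j}) :
    dirExp m α f
      = (Real.Gamma (∑ j, α j) / Real.Gamma ((∑ j, α j) + h)) *
        ∫ θ : Fin m → ℝ in {θ | ∀ j, 0 < θ j},
          f θ * ∏ j, θ j ^ (α j - 1) * Real.exp (-θ j) / Real.Gamma (α j) := by
  obtain ⟨n, rfl⟩ : ∃ n, m = n + 1 := ⟨m - 1, by omega⟩
  set P : Set (Fin (n + 1) → ℝ) := {θ | ∀ j, 0 < θ j} with hP
  have hPm : MeasurableSet P := pos_meas _
  set A := ∑ j, α j with hA
  have hApos : 0 < A := Finset.sum_pos (fun j _ => hα j) ⟨0, Finset.mem_univ _⟩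
  set G : (Fin (n + 1) → ℝ) → ℝ := P.indicator (fun θ =>
    f θ * ∏ j, θ j ^ (α j - 1) * Real.exp (-θ j) / Real.Gamma (α j)) with hG
  set G0 : (Fin (n + 1) → ℝ) → ℝ := P.indicator (fun θ =>
    f θ * (∏ j, θ j ^ (α j - 1)) / ∏ j, Real.Gamma (α j)) with hG0
  have hΓ : (∏ j, Real.Gamma (α j)) ≠ 0 :=
    Finset.prod_ne_zero_iff.2 fun j _ => (Real.Gamma_pos_of_pos (hα j)).ne'
  have hΓA : Real.Gamma A ≠ 0 := (Real.Gamma_pos_of_pos hApos).ne'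
  have hΓB : Real.Gamma (A + h) ≠ 0 := (Real.Gamma_pos_of_pos (by linarith)).ne'
  set K : ℝ := ∫ x : Fin n → ℝ, G0 (cMap n x 1) with hK
  have hcm : Measurable (fun x : Fin n → ℝ => cMap n x 1) :=
    (cEquiv n).measurable.comp (measurable_id.prodMk measurable_const)
  -- left side
  have hL : dirExp (n + 1) α f = Real.Gamma A * K := by
    have e1 : dirExp (n + 1) α f = ∫ x in simplexDom (n + 1),
        Real.Gamma A * (f (cMap n x 1) * (∏ j, (cMap n x 1) j ^ (α j - 1)) /
          ∏ j, Real.Gamma (α j)) := by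
      unfold dirExp
      refine integral_congr_ae (Filter.Eventually.of_forall fun x => ?_)
      have := coordMap_eq n x
      simp only
      rw [this]
      field_simp
      rfl
    rw [e1, integral_const_mul]
    congr 1
    have e2 := setIntegral_congr_set (μ := (volume : Measure (Fin n → ℝ)))
      (f := fun x => (f (cMap n x 1) * (∏ j, (cMap n x 1) j ^ (α j - 1)) /
          ∏ j, Real.Gamma (α j))) (simplex_ae n)
    refine e2.trans ?_
    have e3 : {x : Fin n → ℝ | ∀ j, 0 < cMap n x 1 j} = (fun x => cMap n x 1) ⁻¹' P := by
      ext x; exact Iff.rfl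
    rw [e3, ← integral_indicator (hcm hPm)]
    rfl
  -- right side
  have hGint : Integrable G := (integrable_indicator_iff hPm).2 hf_int
  have hint2 : Integrable (fun z : (Fin n → ℝ) × ℝ => G (cEquiv n z)) volume :=
    (cEquiv_mp n).integrable_comp_of_integrable hGint
  have hR : ∫ θ in P, f θ * ∏ j, θ j ^ (α j - 1) * Real.exp (-θ j) / Real.Gamma (α j)
      = ∫ s : ℝ, ∫ y : Fin n → ℝ, G (cMap n y s) := by
    rw [← integral_indicator hPm]
    change ∫ θ, G θ = _
    rw [← (cEquiv_mp n).integral_comp (cEquiv n).measurableEmbedding]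
    rw [Measure.volume_eq_prod] at hint2 ⊢
    rw [integral_prod_symm _ hint2]
    rfl
  have hscale : ∀ s : ℝ, 0 < s → ∀ x : Fin n → ℝ,
      G (cMap n (s • x) s) = (s ^ (A + h - 1 - n) * Real.exp (-s)) * G0 (cMap n x 1) := by
    intro s hs x
    rw [cMap_smul]
    have hmem : s • cMap n x 1 ∈ P ↔ cMap n x 1 ∈ P := by
      simp only [hP, Set.mem_ofPred_eq, Pi.smul_apply, smul_eq_mul, mul_pos_iff_of_pos_left hs]
    by_cases hx : cMap n x 1 ∈ P
    · rw [hG, hG0, Set.indicator_of_mem (hmem.2 hx), Set.indicator_of_mem hx,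
        hf_hom s hs _ hx, Finset.prod_div_distrib, Finset.prod_mul_distrib, ← Real.exp_sum]
      have a1 : ∑ j, -(s • cMap n x 1) j = -s := by
        simp only [Pi.smul_apply, smul_eq_mul, Finset.sum_neg_distrib, ← Finset.mul_sum, sum_cMap,
          mul_one]
      have a2 : ∏ j, (s • cMap n x 1) j ^ (α j - 1)
          = s ^ (A - (n + 1)) * ∏ j, cMap n x 1 j ^ (α j - 1) := by
        have : ∀ j, (s • cMap n x 1) j ^ (α j - 1)
            = s ^ (α j - 1) * cMap n x 1 j ^ (α j - 1) := fun j => by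
          rw [Pi.smul_apply, smul_eq_mul, Real.mul_rpow hs.le (hx j).le]
        simp only [this]
        rw [Finset.prod_mul_distrib, ← Real.rpow_sum_of_pos hs]
        simp [Finset.sum_sub_distrib, hA]
      have a3 : s ^ (A + h - 1 - n) = s ^ h * s ^ (A - (n + 1)) := by
        rw [← Real.rpow_add hs]; congr 1; ring
      rw [a1, a2, a3]
      ring
    · rw [hG, hG0, Set.indicator_of_notMem (fun q => hx (hmem.1 q)), Set.indicator_of_notMem hx,
        mul_zero]
  have hinner : ∀ s : ℝ, ∫ y : Fin n → ℝ, G (cMap n y s)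
      = (Set.Ioi (0 : ℝ)).indicator (fun s => (Real.exp (-s) * s ^ (A + h - 1)) * K) s := by
    intro s
    by_cases hs : 0 < s
    · rw [Set.indicator_of_mem (Set.mem_Ioi.2 hs)]
      have e := Measure.integral_comp_smul (volume : Measure (Fin n → ℝ))
        (fun y => G (cMap n y s)) s
      simp only [hscale s hs] at e
      rw [integral_const_mul] at e
      have hsn : (0 : ℝ) < s ^ n := pow_pos hs n
      rw [Module.finrank_fin_fun, abs_of_pos (inv_pos.2 hsn), smul_eq_mul] at e
      have a4 : s ^ (A + h - 1) = s ^ n * s ^ (A + h - 1 - n) := by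
        rw [← Real.rpow_natCast, ← Real.rpow_add hs]; congr 1; ring
      rw [a4]
      field_simp at e
      rw [← e]
      ring
    · rw [Set.indicator_of_notMem (by simpa using hs)]
      have : ∀ y, G (cMap n y s) = 0 := by
        intro y
        apply Set.indicator_of_notMem
        intro hy
        apply hs
        rw [← sum_cMap n y s]
        exact Finset.sum_pos (fun j _ => hy j) ⟨0, Finset.mem_univ _⟩
      simp [this]
  rw [hL, hR]
  simp only [hinner]
  rw [integral_indicator measurableSet_Ioi, integral_mul_const,
    ← Real.Gamma_eq_integral (by linarith)]
  field_simp
end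

section
/- E_{Dir(α)}[∏_{i=1}^n ∑_{j=1}^m β i j · θ_j] = (Γ(|α|) / Γ(|α| + n)) · p̃(Fin n), i.e. the probability p(w_1,…,w_n | α, β) of the observations under the Dirichlet prior equals Γ(|α|)/Γ(|α|+n) times the expectation of the same product under independent Gamma(α_j,1) variables. -/
open MeasureTheory Real Finset

/-- The unnormalized probability `p̃(K)`: the expectation of
`∏_{i∈K} ∑_j β i j θ_j` under independent `Gamma(α_j, 1)` variables. -/
noncomputable def ptilde (n m : ℕ) (α : Fin m → ℝ) (β : Fin n → Fin m → ℝ)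
    (K : Finset (Fin n)) : ℝ :=
  ∫ θ : Fin m → ℝ in {θ | ∀ j, 0 < θ j},
    (∏ j, θ j ^ (α j - 1) * Real.exp (-θ j) / Real.Gamma (α j)) *
      ∏ i ∈ K, (∑ j, β i j * θ j)

theorem int_fubini (k : ℕ) (F : (Fin (k+1) → ℝ) → ℝ) (hF : Integrable F) :
    ∫ θ, F θ = ∫ s : ℝ, ∫ y : Fin k → ℝ, F (Fin.snoc (α := fun _ => ℝ) y (s - ∑ j, y j)) := by
  have he := (volume_preserving_piFinSuccAbove (fun _ : Fin (k+1) => ℝ) (Fin.last k)).symm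
  have h1 : ∀ p : ℝ × (Fin k → ℝ), (MeasurableEquiv.piFinSuccAbove (fun _ : Fin (k+1) => ℝ) (Fin.last k)).symm p
      = Fin.snoc (α := fun _ => ℝ) p.2 p.1 := by
    intro p
    rw [MeasurableEquiv.piFinSuccAbove_symm_apply]
    exact Fin.insertNth_last' _ _
  set G : ℝ × (Fin k → ℝ) → ℝ := fun p => F (Fin.snoc (α := fun _ => ℝ) p.2 p.1) with hG
  have hGi : Integrable G := by
    have := he.integrable_comp_of_integrable hF
    refine this.congr (Filter.Eventually.of_forall fun p => ?_)
    simp only [Function.comp, h1, hG]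
  have hGe : ∫ θ, F θ = ∫ p, G p := by
    rw [← he.integral_comp']
    simp only [h1, hG]
  have hGs : Integrable (fun p : (Fin k → ℝ) × ℝ => G p.swap) := hGi.swap
  have hsh : MeasurePreserving (fun p : (Fin k → ℝ) × ℝ => (p.1, p.2 - ∑ j, p.1 j)) := by
    refine MeasurePreserving.skew_product (f := id) (g := fun (y : Fin k → ℝ) (s : ℝ) => s - ∑ j, y j)
      (MeasurePreserving.id _) ?_ ?_
    · fun_prop
    · refine Filter.Eventually.of_forall fun y => ?_
      exact (measurePreserving_sub_right volume (∑ j, y j)).map_eq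
  have hHi : Integrable (fun p : (Fin k → ℝ) × ℝ => G (p.2 - ∑ j, p.1 j, p.1)) :=
    hsh.integrable_comp_of_integrable hGs
  rw [hGe]
  erw [integral_prod_symm _ hGi]
  erw [← integral_integral_swap (f := fun (y : Fin k → ℝ) (s : ℝ) => G (s - ∑ j, y j, y)) hHi]
  congr 1
  ext y
  exact (integral_sub_right_eq_self (fun t => G (t, y)) (∑ j, y j)).symm

theorem pint (n m : ℕ) (α : Fin m → ℝ) (hα : ∀ j, 0 < α j) (β : Fin n → Fin m → ℝ) :
    IntegrableOn (fun θ : Fin m → ℝ => (∏ j, θ j ^ (α j - 1) * Real.exp (-θ j)) *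
      ∏ i, (∑ j, β i j * θ j)) {θ | ∀ j, 0 < θ j} := by
  have hset : {θ : Fin m → ℝ | ∀ j, 0 < θ j} = Set.univ.pi fun _ => Set.Ioi 0 := by
    ext; simp
  have key : ∀ f : Fin n → Fin m, IntegrableOn (fun θ : Fin m → ℝ =>
      (∏ j, θ j ^ (α j - 1) * Real.exp (-θ j)) * ∏ i, (β i (f i) * θ (f i)))
      {θ | ∀ j, 0 < θ j} := by
    intro f
    have : IntegrableOn (fun θ : Fin m → ℝ => (∏ i, β i (f i)) *
      ∏ j, (Real.exp (-θ j) * θ j ^ (α j + #{i | f i = j} - 1))) {θ | ∀ j, 0 < θ j} := by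
      refine Integrable.const_mul ?_ _
      rw [hset, volume_pi, Measure.restrict_pi_pi]
      refine Integrable.fintype_prod (f := fun j (t : ℝ) => Real.exp (-t) * t ^ (α j + #{i | f i = j} - 1)) fun j => ?_
      exact Real.GammaIntegral_convergent (by have := hα j; positivity)
    refine this.congr_fun ?_ (by rw [hset]; exact MeasurableSet.univ_pi fun _ => measurableSet_Ioi)
    intro θ hθ
    simp only [Set.mem_ofPred_eq] at hθ
    simp only [Finset.prod_mul_distrib]
    have h2 : ∏ i, θ (f i) = ∏ j, θ j ^ #{i | f i = j} := by
      rw [Finset.prod_comp (fun j => θ j) f]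
      symm
      refine (Finset.prod_subset (Finset.subset_univ _) ?_).symm
      intro j _ hj
      have : #{i | f i = j} = 0 := by
        simp only [Finset.mem_image, Finset.mem_univ, true_and, not_exists] at hj
        simpa [Finset.filter_eq_empty_iff] using hj
      rw [this, pow_zero]
    have h3 : ∏ j, θ j ^ (α j + #{i | f i = j} - 1) = (∏ j, θ j ^ (α j - 1)) * ∏ j, θ j ^ #{i | f i = j} := by
      rw [← Finset.prod_mul_distrib]
      refine Finset.prod_congr rfl fun j _ => ?_
      rw [← Real.rpow_natCast, ← Real.rpow_add (hθ j)]
      congr 1; ring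
    rw [h2, h3]; ring
  have := integrable_finsetSum (μ := volume.restrict {θ : Fin m → ℝ | ∀ j, 0 < θ j}) (Finset.univ : Finset (Fin n → Fin m)) (fun f _ => key f)
  refine this.congr (Filter.Eventually.of_forall fun θ => ?_)
  simp only [Finset.prod_univ_sum, Fintype.piFinset_univ, Finset.mul_sum]

theorem dirichlet_prob_eq_gamma (n m : ℕ) (hn : 1 ≤ n) (hm : 1 ≤ m)
    (α : Fin m → ℝ) (hα : ∀ j, 0 < α j) (β : Fin n → Fin m → ℝ) :
    dirExp m α (fun θ => ∏ i : Fin n, ∑ j, β i j * θ j)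
      = (Real.Gamma (∑ j, α j) / Real.Gamma ((∑ j, α j) + n)) *
        ptilde n m α β Finset.univ := by
  obtain ⟨k, rfl⟩ : ∃ k, m = k + 1 := ⟨m - 1, by omega⟩
  set A := ∑ j, α j with hA
  have hApos : 0 < A := Finset.sum_pos (fun j _ => hα j) Finset.univ_nonempty
  set P : (Fin (k+1) → ℝ) → ℝ := fun θ => ∏ i : Fin n, ∑ j, β i j * θ j with hP
  set h : (Fin (k+1) → ℝ) → ℝ := fun θ => P θ * ∏ j, θ j ^ (α j - 1) with hh
  set O : Set (Fin (k+1) → ℝ) := {θ | ∀ j, 0 ≤ θ j} with hO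
  have hOset : O = Set.univ.pi fun _ => Set.Ici 0 := by ext; simp only [hO, Set.mem_ofPred_eq, Set.mem_pi, Set.mem_univ, true_implies, Set.mem_Ici]
  have hOm : MeasurableSet O := by rw [hOset]; exact MeasurableSet.univ_pi fun _ => measurableSet_Ici
  have hae : ({θ : Fin (k+1) → ℝ | ∀ j, 0 < θ j} : Set _) =ᵐ[volume] O := by
    have e : {θ : Fin (k+1) → ℝ | ∀ j, 0 < θ j} = Set.univ.pi fun _ => Set.Ioi 0 := by
      ext; simp
    have e' : O = Set.Ici (fun _ => (0:ℝ)) := rfl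
    rw [e, e']
    exact Measure.univ_pi_Ioi_ae_eq_Ici
  set F : (Fin (k+1) → ℝ) → ℝ := O.indicator fun θ => h θ * Real.exp (-∑ j, θ j) with hFd
  have hFint : Integrable F := by
    rw [hFd, integrable_indicator_iff hOm]
    refine IntegrableOn.congr_set_ae ?_ hae.symm
    refine (pint n (k+1) α hα β).congr (Filter.Eventually.of_forall fun θ => ?_)
    simp only [hh, hP, Finset.prod_mul_distrib, ← Finset.sum_neg_distrib, Real.exp_sum]
    ring
  have hpt : ptilde n (k+1) α β Finset.univ = (∏ j, Real.Gamma (α j))⁻¹ * ∫ θ, F θ := by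
    rw [hFd, integral_indicator hOm, ptilde, setIntegral_congr_set hae, ← integral_const_mul]
    congr 1
    ext θ
    simp only [hh, hP, Finset.prod_mul_distrib, Finset.prod_div_distrib,
      ← Finset.sum_neg_distrib, Real.exp_sum]
    ring
  set S : Set (Fin k → ℝ) := simplexDom (k+1) with hS
  have hSm : MeasurableSet S := by
    have : S = (⋂ j, {x | 0 ≤ x j}) ∩ {x | ∑ j, x j ≤ 1} := by
      ext x; simp [hS, simplexDom]
    rw [this]
    refine (MeasurableSet.iInter fun j => measurableSet_le (by fun_prop) (by fun_prop)).inter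
      (measurableSet_le (by fun_prop) (by fun_prop))
  set c : (Fin k → ℝ) → (Fin (k+1) → ℝ) := coordMap (k+1) with hc
  have hcs : ∀ x, c x = Fin.snoc (α := fun _ => ℝ) x (1 - ∑ j, x j) := by
    intro x
    ext j
    refine Fin.lastCases ?_ (fun i => ?_) j
    · simp [hc, coordMap]
    · simp [hc, coordMap]
  have hcsum : ∀ x, ∑ j, c x j = 1 := by
    intro x; rw [hcs, Fin.sum_univ_castSucc]; simp
  have hmem : ∀ x, c x ∈ O ↔ x ∈ S := by
    intro x
    simp only [hO, Set.mem_ofPred_eq, hcs, Fin.forall_fin_succ', Fin.snoc_castSucc, Fin.snoc_last]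
    simp [hS, simplexDom]
  have hD : dirExp (k+1) α P = (∏ j, Real.Gamma (α j))⁻¹ * Real.Gamma A * ∫ x in S, h (c x) := by
    rw [dirExp, ← integral_const_mul]
    congr 1
    ext x
    simp only [hh, hc, div_eq_mul_inv, mul_inv, inv_inv]
    ring
  have hhom : ∀ s : ℝ, 0 < s → ∀ θ ∈ O, h (s • θ) = s ^ (A - (k+1) + n) * h θ := by
    intro s hs θ hθ
    have e1 : P (s • θ) = s ^ n * P θ := by
      have : ∀ i, ∑ j, β i j * (s • θ) j = s * ∑ j, β i j * θ j := by
        intro i; rw [Finset.mul_sum]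
        refine Finset.sum_congr rfl fun j _ => ?_
        simp only [Pi.smul_apply, smul_eq_mul]; ring
      simp only [hP, this, Finset.prod_mul_distrib, Finset.prod_const, Finset.card_univ, Fintype.card_fin]
    have e2 : ∏ j, (s • θ) j ^ (α j - 1) = s ^ (A - (k+1)) * ∏ j, θ j ^ (α j - 1) := by
      have : ∀ j, (s • θ) j ^ (α j - 1) = s ^ (α j - 1) * θ j ^ (α j - 1) := fun j => by
        rw [Pi.smul_apply, smul_eq_mul, Real.mul_rpow hs.le (hθ j)]
      simp only [this, Finset.prod_mul_distrib]
      rw [← Real.rpow_sum_of_pos hs]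
      congr 2
      simp [hA]
    simp only [hh]
    rw [e1, e2, Real.rpow_add hs, Real.rpow_natCast]; ring
  have hin : ∀ s : ℝ, 0 < s → ∫ y : Fin k → ℝ, F (Fin.snoc (α := fun _ => ℝ) y (s - ∑ j, y j))
      = (Real.exp (-s) * s ^ (A + n - 1)) * ∫ x in S, h (c x) := by
    intro s hs
    have e0 : ∀ x : Fin k → ℝ, F (Fin.snoc (α := fun _ => ℝ) (s • x) (s - ∑ j, (s • x) j))
        = (Real.exp (-s) * s ^ (A - (k+1) + n)) * S.indicator (fun x => h (c x)) x := by
      intro x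
      have : Fin.snoc (α := fun _ => ℝ) (s • x) (s - ∑ j, (s • x) j) = s • c x := by
        rw [hcs]
        ext j
        refine Fin.lastCases ?_ (fun i => ?_) j
        · simp [← Finset.mul_sum]; ring
        · simp
      rw [this]
      have hiff : s • c x ∈ O ↔ c x ∈ O := by
        simp only [hO, Set.mem_ofPred_eq, Pi.smul_apply, smul_eq_mul, mul_nonneg_iff_of_pos_left hs]
      by_cases hx : x ∈ S
      · have hx' := (hmem x).2 hx
        rw [hFd, Set.indicator_of_mem (hiff.2 hx'), Set.indicator_of_mem hx, hhom s hs _ hx']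
        have : ∑ j, (s • c x) j = s := by
          simp only [Pi.smul_apply, smul_eq_mul, ← Finset.mul_sum, hcsum, mul_one]
        rw [this]; ring
      · have hx' := fun q => hx ((hmem x).1 q)
        rw [hFd, Set.indicator_of_notMem (fun q => hx' (hiff.1 q)), Set.indicator_of_notMem hx, mul_zero]
    have e1 := Measure.integral_comp_smul (volume : Measure (Fin k → ℝ))
      (fun y => F (Fin.snoc (α := fun _ => ℝ) y (s - ∑ j, y j))) s
    simp only [e0] at e1
    rw [integral_const_mul, integral_indicator hSm, Module.finrank_fin_fun, abs_of_pos (by positivity),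
      smul_eq_mul] at e1
    have hsk : s ^ k ≠ 0 := by positivity
    have e2 : s ^ (A + n - 1) = s ^ k * s ^ (A - (k+1) + n) := by
      rw [← Real.rpow_natCast, ← Real.rpow_add hs]; congr 1; ring
    rw [e2]
    rw [eq_inv_mul_iff_mul_eq₀ hsk] at e1
    rw [← e1]; ring
  have hneg : ∀ s : ℝ, s < 0 → ∫ y : Fin k → ℝ, F (Fin.snoc (α := fun _ => ℝ) y (s - ∑ j, y j)) = 0 := by
    intro s hs
    have : ∀ y : Fin k → ℝ, F (Fin.snoc (α := fun _ => ℝ) y (s - ∑ j, y j)) = 0 := by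
      intro y
      refine Set.indicator_of_notMem (fun q => ?_) _
      have := Finset.sum_nonneg (s := Finset.univ) (fun j _ => q j)
      rw [Fin.sum_univ_castSucc] at this
      simp at this
      linarith
    simp [this]
  have hFI : ∫ θ, F θ = Real.Gamma (A + n) * ∫ x in S, h (c x) := by
    rw [int_fubini k F hFint, Real.Gamma_eq_integral (by positivity), ← integral_mul_const,
      ← setIntegral_congr_fun measurableSet_Ioi (fun s hs => hin s hs)]
    rw [← integral_indicator measurableSet_Ioi]
    refine integral_congr_ae ?_
    have : ∀ᵐ s : ℝ, s ≠ 0 := by simp [ae_iff]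
    filter_upwards [this] with s hs
    rcases lt_or_gt_of_ne hs with h0 | h0
    · rw [hneg s h0, Set.indicator_of_notMem (by simpa using h0.le)]
    · rw [Set.indicator_of_mem (by simpa using h0)]
  have hG : Real.Gamma (A + n) ≠ 0 := (Real.Gamma_pos_of_pos (by positivity)).ne'
  rw [hD, hpt, hFI]
  field_simp
end

section
/- ∫_{(0,∞)^m} (∏_{j=1}^m θ_j^{α_j − 1} e^{−θ_j} / Γ(α_j)) · ∏_{i=1}^n (∑_{j=1}^m β i j · θ_j) dθ = ∑_{π ∈ Part(Fin n)} ∏_{J ∈ π} ((|J| − 1)! · ⟨β_J⟩). In other words, the unnormalized probability p̃(Fin n) equals the sum over all set partitions π of the n observations of the product, over the blocks J of π, of Γ(|J|)·⟨β_J⟩. (Here β : Fin n → Fin m → ℝ may be an arbitrary real matrix.) -/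
open MeasureTheory Real Finset

noncomputable def gdens {m : ℕ} (α : Fin m → ℝ) (θ : Fin m → ℝ) : ℝ :=
  ∏ j, θ j ^ (α j - 1) * Real.exp (-θ j) / Real.Gamma (α j)

noncomputable def EI {m : ℕ} (α : Fin m → ℝ) (p : MvPolynomial (Fin m) ℝ) : ℝ :=
  ∫ θ : Fin m → ℝ in {θ | ∀ j, 0 < θ j}, gdens α θ * MvPolynomial.eval θ p

lemma restr_eq (m : ℕ) : (volume : Measure (Fin m → ℝ)).restrict {θ | ∀ j, 0 < θ j}
    = Measure.pi (fun _ : Fin m => (volume : Measure ℝ).restrict (Set.Ioi 0)) := by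
  have : {θ : Fin m → ℝ | ∀ j, 0 < θ j} = Set.univ.pi (fun _ => Set.Ioi 0) := by
    ext; simp
  rw [this, volume_pi, Measure.restrict_pi_pi]

lemma one_int {a : ℝ} (ha : 0 < a) (k : ℕ) :
    Integrable (fun x : ℝ => x ^ (a - 1) * Real.exp (-x) / Real.Gamma a * x ^ k)
      (volume.restrict (Set.Ioi 0)) ∧
    ∫ x in Set.Ioi (0:ℝ), x ^ (a - 1) * Real.exp (-x) / Real.Gamma a * x ^ k
      = Real.Gamma (a + k) / Real.Gamma a := by
  have hk : 0 < a + k := by positivity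
  have hE : Set.EqOn (fun x : ℝ => Real.exp (-x) * x ^ (a + k - 1) / Real.Gamma a) 
      (fun x : ℝ => x ^ (a - 1) * Real.exp (-x) / Real.Gamma a * x ^ k) (Set.Ioi 0) := by
    intro x hx
    have hx : 0 < x := hx
    have : x ^ (a + k - 1) = x ^ (a - 1) * x ^ k := by
      rw [← Real.rpow_natCast, ← Real.rpow_add hx]; congr 1; ring
    simp only [this]; ring
  constructor
  · exact IntegrableOn.congr_fun ((Real.GammaIntegral_convergent hk).div_const _) hE measurableSet_Ioi
  · rw [← setIntegral_congr_fun measurableSet_Ioi hE, integral_div, ← Real.Gamma_eq_integral hk]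

lemma mon_eq {m : ℕ} (α : Fin m → ℝ) (s : Fin m →₀ ℕ) (c : ℝ) (θ : Fin m → ℝ) :
    gdens α θ * MvPolynomial.eval θ (MvPolynomial.monomial s c)
     = c * ∏ j, (θ j ^ (α j - 1) * Real.exp (-θ j) / Real.Gamma (α j) * θ j ^ s j) := by
  rw [MvPolynomial.eval_monomial, Finsupp.prod_fintype _ _ (by simp), Finset.prod_mul_distrib, gdens]
  ring

lemma mon_int {m : ℕ} (α : Fin m → ℝ) (hα : ∀ j, 0 < α j) (s : Fin m →₀ ℕ) (c : ℝ) :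
    Integrable (fun θ => gdens α θ * MvPolynomial.eval θ (MvPolynomial.monomial s c))
      ((volume : Measure (Fin m → ℝ)).restrict {θ | ∀ j, 0 < θ j}) := by
  rw [restr_eq]
  simp only [mon_eq]
  apply Integrable.const_mul
  exact Integrable.fintype_prod (fun j => (one_int (hα j) (s j)).1)

lemma EI_mon {m : ℕ} (α : Fin m → ℝ) (hα : ∀ j, 0 < α j) (s : Fin m →₀ ℕ) (c : ℝ) :
    EI α (MvPolynomial.monomial s c) = c * ∏ j, (Real.Gamma (α j + s j) / Real.Gamma (α j)) := by
  rw [EI, restr_eq]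
  simp only [mon_eq]
  rw [integral_const_mul, integral_fintype_prod_eq_prod
    (f := fun j x => x ^ (α j - 1) * Real.exp (-x) / Real.Gamma (α j) * x ^ s j)]
  congr 1
  exact Finset.prod_congr rfl fun j _ => (one_int (hα j) (s j)).2

lemma poly_int {m : ℕ} (α : Fin m → ℝ) (hα : ∀ j, 0 < α j) (p : MvPolynomial (Fin m) ℝ) :
    Integrable (fun θ => gdens α θ * MvPolynomial.eval θ p)
      ((volume : Measure (Fin m → ℝ)).restrict {θ | ∀ j, 0 < θ j}) := by
  induction p using MvPolynomial.induction_on' with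
  | monomial s c => exact mon_int α hα s c
  | add p q hp hq => simp only [map_add, mul_add]; exact hp.add hq

lemma EI_add {m : ℕ} (α : Fin m → ℝ) (hα : ∀ j, 0 < α j) (p q : MvPolynomial (Fin m) ℝ) :
    EI α (p + q) = EI α p + EI α q := by
  simp only [EI, map_add, mul_add]
  exact integral_add (poly_int α hα p) (poly_int α hα q)

lemma EI_smul {m : ℕ} (α : Fin m → ℝ) (c : ℝ) (p : MvPolynomial (Fin m) ℝ) :
    EI α (c • p) = c * EI α p := by
  simp only [EI, MvPolynomial.smul_eval, ← integral_const_mul]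
  congr 1; ext θ; ring

noncomputable def EL {m : ℕ} (α : Fin m → ℝ) (hα : ∀ j, 0 < α j) :
    MvPolynomial (Fin m) ℝ →ₗ[ℝ] ℝ where
  toFun := EI α
  map_add' := EI_add α hα
  map_smul' c p := EI_smul α c p

lemma EL_X {m : ℕ} (α : Fin m → ℝ) (hα : ∀ j, 0 < α j) (j : Fin m)
    (p : MvPolynomial (Fin m) ℝ) :
    EL α hα (MvPolynomial.X j * p) = α j * EL α hα p
      + EL α hα (MvPolynomial.X j * MvPolynomial.pderiv j p) := by
  induction p using MvPolynomial.induction_on' with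
  | add p q hp hq => simp only [map_add, mul_add, hp, hq]; ring
  | monomial s c =>
    rw [MvPolynomial.X_mul_pderiv_monomial, map_nsmul, nsmul_eq_mul, ← add_mul, MvPolynomial.X,
      MvPolynomial.monomial_mul, one_mul]
    change EI α _ = _ * EI α _
    rw [EI_mon α hα, EI_mon α hα, ← Finset.mul_prod_erase _ _ (Finset.mem_univ j),
      ← Finset.mul_prod_erase (a := j) _ _ (Finset.mem_univ j)]
    have h1 : ∏ x ∈ Finset.univ.erase j, Real.Gamma (α x + ((Finsupp.single j 1 + s : Fin m →₀ ℕ) x : ℕ)) / Real.Gamma (α x)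
        = ∏ x ∈ Finset.univ.erase j, Real.Gamma (α x + (s x : ℕ)) / Real.Gamma (α x) := by
      refine Finset.prod_congr rfl fun x hx => ?_
      have : j ≠ x := fun h => by simp [h] at hx
      simp [Finsupp.single_apply, this]
    rw [h1]
    have h2 : Real.Gamma (α j + ((Finsupp.single j 1 + s : Fin m →₀ ℕ) j : ℕ))
        = (α j + s j) * Real.Gamma (α j + s j) := by
      have := hα j
      rw [← Real.Gamma_add_one (by positivity)]
      congr 1
      simp; ring
    rw [h2]; ring

/-- linear forms -/
noncomputable def lf {n m : ℕ} (β : Fin n → Fin m → ℝ) (i : Fin n) : MvPolynomial (Fin m) ℝ :=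
  ∑ j, β i j • MvPolynomial.X j

lemma pd_lf {n m : ℕ} (β : Fin n → Fin m → ℝ) (i : Fin n) (j : Fin m) :
    MvPolynomial.pderiv j (lf β i) = MvPolynomial.C (β i j) := by
  classical
  simp only [lf, map_sum, Derivation.map_smul, MvPolynomial.pderiv_X]
  rw [Finset.sum_eq_single j]
  · simp [MvPolynomial.smul_eq_C_mul]
  · intro b _ hb; simp [Pi.single_apply, hb.symm, hb]
  · simp

lemma der_prod {n m : ℕ} (j : Fin m) (f : Fin n → MvPolynomial (Fin m) ℝ) (K : Finset (Fin n)) :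
    MvPolynomial.pderiv j (∏ i ∈ K, f i)
      = ∑ i ∈ K, (∏ k ∈ K.erase i, f k) • MvPolynomial.pderiv j (f i) := by
  induction K using Finset.induction_on with
  | empty => simp
  | insert a K ha ih =>
    rw [Finset.prod_insert ha, Derivation.leibniz, Finset.sum_insert ha, Finset.erase_insert ha, ih,
      Finset.smul_sum, add_comm]
    congr 1
    refine Finset.sum_congr rfl fun i hi => ?_
    have hia : i ≠ a := by rintro rfl; exact ha hi
    rw [Finset.erase_insert_of_ne hia.symm, Finset.prod_insert (by simp [ha]), smul_smul]

lemma EL_rec {n m : ℕ} (α : Fin m → ℝ) (hα : ∀ j, 0 < α j) (β : Fin n → Fin m → ℝ) (j : Fin m)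
    (K : Finset (Fin n)) :
    EL α hα (MvPolynomial.X j * ∏ i ∈ K, lf β i) = α j * EL α hα (∏ i ∈ K, lf β i)
      + ∑ i ∈ K, β i j * EL α hα (MvPolynomial.X j * ∏ i ∈ K.erase i, lf β i) := by
  rw [EL_X, der_prod, Finset.mul_sum, map_sum]
  congr 1
  refine Finset.sum_congr rfl fun i _ => ?_
  rw [pd_lf, ← smul_eq_mul (β i j), ← LinearMap.map_smul (EL α hα), MvPolynomial.smul_eq_C_mul,
    smul_eq_mul]
  congr 1; ring

lemma EL_sub {n m : ℕ} (α : Fin m → ℝ) (hα : ∀ j, 0 < α j) (β : Fin n → Fin m → ℝ) (j : Fin m)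
    (K : Finset (Fin n)) :
    EL α hα (MvPolynomial.X j * ∏ i ∈ K, lf β i) =
      ∑ L ∈ K.powerset, α j * ((L.card.factorial : ℝ) * ∏ i ∈ L, β i j) *
         EL α hα (∏ i ∈ K \ L, lf β i) := by
  induction K using Finset.strongInduction with
  | H K ih =>
    rw [EL_rec, ← Finset.add_sum_erase _ _ (Finset.empty_mem_powerset K)]
    congr 1
    · simp
    have e1 : ∀ i ∈ K, β i j * EL α hα (MvPolynomial.X j * ∏ i ∈ K.erase i, lf β i)
        = ∑ M ∈ K.powerset.erase ∅, if i ∈ M then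
          α j * (((M.card - 1).factorial : ℝ) * ∏ i ∈ M, β i j) *
            EL α hα (∏ i ∈ K \ M, lf β i) else 0 := by
      intro i hi
      rw [ih _ (Finset.erase_ssubset hi), Finset.mul_sum, ← Finset.sum_filter]
      refine Finset.sum_nbij' (fun L => insert i L) (fun M => M.erase i) ?_ ?_ ?_ ?_ ?_
      · intro L hL
        simp only [Finset.mem_powerset, Finset.mem_filter, Finset.mem_erase] at *
        refine ⟨⟨by simp, ?_⟩, by simp⟩
        exact Finset.insert_subset hi (hL.trans (Finset.erase_subset _ _))
      · intro M hM
        simp only [Finset.mem_powerset, Finset.mem_filter, Finset.mem_erase] at *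
        exact Finset.erase_subset_erase _ hM.1.2
      · intro L hL
        have : i ∉ L := fun h => by simpa using Finset.mem_powerset.1 hL h
        exact Finset.erase_insert this
      · intro M hM
        exact Finset.insert_erase (Finset.mem_filter.1 hM).2
      · intro L hL
        have : i ∉ L := fun h => by simpa using Finset.mem_powerset.1 hL h
        have h3 : K.erase i \ L = K \ insert i L := by ext; simp; tauto
        rw [Finset.card_insert_of_notMem this, Finset.prod_insert this, h3]
        simp only [Nat.add_sub_cancel]; ring
    rw [Finset.sum_congr rfl e1, Finset.sum_comm]
    refine Finset.sum_congr rfl fun M hM => ?_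
    simp only [Finset.mem_powerset, Finset.mem_erase] at hM
    rw [← Finset.sum_filter, Finset.filter_mem_eq_inter, Finset.inter_eq_right.2 hM.2,
      Finset.sum_const, nsmul_eq_mul]
    have : (M.card.factorial : ℝ) = M.card * ((M.card - 1).factorial : ℝ) := by
      have := Nat.mul_factorial_pred (Finset.card_ne_zero.2 (Finset.nonempty_iff_ne_empty.2 hM.1))
      exact_mod_cast this.symm
    rw [this]; ring

/-- partitions as plain sets of blocks -/
def Pt {ι : Type} [DecidableEq ι] (K : Finset ι) : Finset (Finset (Finset ι)) :=
  (Finset.univ : Finset (Finpartition K)).image Finpartition.parts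

lemma mem_Pt {ι : Type} [DecidableEq ι] (K : Finset ι) (pp : Finset (Finset ι)) :
    pp ∈ Pt K ↔ ∅ ∉ pp ∧ (∀ J ∈ pp, J ⊆ K) ∧ ∀ x ∈ K, ∃! J, J ∈ pp ∧ x ∈ J := by
  simp only [Pt, Finset.mem_image, Finset.mem_univ, true_and]
  constructor
  · rintro ⟨P, rfl⟩
    exact ⟨P.bot_notMem, fun J hJ => P.le hJ, fun x hx => P.existsUnique_mem hx⟩
  · rintro ⟨h1, h2, h3⟩
    exact ⟨Finpartition.ofExistsUnique pp h2 (by simpa [ExistsUnique, and_assoc] using h3) h1, rfl⟩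

lemma sum_Pt {ι : Type} [DecidableEq ι] (K : Finset ι) (w : Finset ι → ℝ) :
    ∑ P : Finpartition K, ∏ J ∈ P.parts, w J = ∑ pp ∈ Pt K, ∏ J ∈ pp, w J := by
  rw [Pt, Finset.sum_image]
  intro P _ Q _ h
  exact Finpartition.ext h

lemma Pt_empty {ι : Type} [DecidableEq ι] : Pt (∅ : Finset ι) = {∅} := by
  ext pp
  rw [mem_Pt]
  simp only [Finset.mem_singleton, Finset.subset_empty]
  constructor
  · rintro ⟨h1, h2, -⟩
    refine Finset.eq_empty_of_forall_notMem fun J hJ => h1 ?_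
    rwa [← h2 J hJ]
  · rintro rfl; simp

lemma Pt_rec {ι : Type} [DecidableEq ι] (K : Finset ι) (a : ι) (ha : a ∉ K) (w : Finset ι → ℝ) :
    ∑ pp ∈ Pt (insert a K), ∏ J ∈ pp, w J =
      ∑ L ∈ K.powerset, w (insert a L) * ∑ pp ∈ Pt (K \ L), ∏ J ∈ pp, w J := by
  simp only [Finset.mul_sum]
  rw [Finset.sum_sigma']
  symm
  have key : ∀ L ∈ K.powerset, ∀ Q ∈ Pt (K \ L), ∀ J ∈ Q, a ∉ J := by
    intro L hL Q hQ J hJ h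
    have := ((mem_Pt _ _).1 hQ).2.1 J hJ h
    simp [ha] at this
  refine Finset.sum_bij (fun x _ => insert (insert a x.1) x.2) ?_ ?_ ?_ ?_
  · rintro ⟨L, Q⟩ hx
    rw [Finset.mem_sigma] at hx
    obtain ⟨hL, hQ⟩ := hx
    have hk := key L hL Q hQ
    simp only [Finset.mem_powerset] at hL hQ
    rw [mem_Pt] at hQ ⊢
    obtain ⟨h1, h2, h3⟩ := hQ
    refine ⟨?_, ?_, ?_⟩
    · simp only [Finset.mem_insert, not_or]
      exact ⟨(Finset.insert_ne_empty _ _).symm, h1⟩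
    · intro J hJ
      rcases Finset.mem_insert.1 hJ with rfl | hJ
      · exact Finset.insert_subset_insert _ hL
      · exact (h2 J hJ).trans (Finset.sdiff_subset.trans (Finset.subset_insert _ _))
    · intro x hx
      by_cases hxL : x ∈ insert a L
      · refine ⟨insert a L, ⟨by simp, hxL⟩, ?_⟩
        rintro J ⟨hJ, hxJ⟩
        rcases Finset.mem_insert.1 hJ with rfl | hJ2
        · rfl
        · exfalso
          rcases Finset.mem_insert.1 hxL with rfl | hxL
          · exact hk J hJ2 hxJ
          · exact (Finset.mem_sdiff.1 (h2 J hJ2 hxJ)).2 hxL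
      · have hxK : x ∈ K \ L := by
          simp only [Finset.mem_insert, not_or] at hxL hx
          simp only [Finset.mem_sdiff]; tauto
        obtain ⟨J, ⟨hJ, hxJ⟩, hu⟩ := h3 x hxK
        refine ⟨J, ⟨Finset.mem_insert_of_mem hJ, hxJ⟩, ?_⟩
        rintro J' ⟨hJ', hxJ'⟩
        rcases Finset.mem_insert.1 hJ' with rfl | hJ'
        · exact absurd hxJ' hxL
        · exact hu J' ⟨hJ', hxJ'⟩
  · rintro ⟨L, Q⟩ hx ⟨L', Q'⟩ hx' h
    rw [Finset.mem_sigma] at hx hx'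
    have hk := key L hx.1 Q hx.2
    have hk' := key L' hx'.1 Q' hx'.2
    have haL : a ∉ L := fun h => ha (Finset.mem_powerset.1 hx.1 h)
    have haL' : a ∉ L' := fun h => ha (Finset.mem_powerset.1 hx'.1 h)
    simp only at h
    have h5 : insert a L = insert a L' := by
      have : insert a L ∈ insert (insert a L') Q' := h ▸ Finset.mem_insert_self _ _
      rcases Finset.mem_insert.1 this with h | h
      · exact h
      · exact absurd (Finset.mem_insert_self a L) (hk' _ h)
    have h6 : L = L' := by rw [← Finset.erase_insert haL, h5, Finset.erase_insert haL']
    subst h6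
    have n1 : insert a L ∉ Q := fun h => hk _ h (Finset.mem_insert_self _ _)
    have n2 : insert a L ∉ Q' := fun h => hk' _ h (Finset.mem_insert_self _ _)
    have h7 : Q = Q' := by rw [← Finset.erase_insert n1, h, Finset.erase_insert n2]
    rw [h7]
  · intro pp hpp
    rw [mem_Pt] at hpp
    obtain ⟨h1, h2, h3⟩ := hpp
    obtain ⟨B, ⟨hB, haB⟩, hu⟩ := h3 a (Finset.mem_insert_self _ _)
    have hBK : B.erase a ⊆ K := fun x hx => by
      have := h2 B hB (Finset.mem_of_mem_erase hx)
      simp only [Finset.mem_insert] at this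
      exact this.resolve_left (Finset.ne_of_mem_erase hx)
    refine ⟨⟨B.erase a, pp.erase B⟩, ?_, ?_⟩
    · rw [Finset.mem_sigma]
      refine ⟨Finset.mem_powerset.2 hBK, ?_⟩
      rw [mem_Pt]
      refine ⟨fun h => h1 (Finset.mem_of_mem_erase h), ?_, ?_⟩
      · intro J hJ x hx
        have hJ' := Finset.mem_of_mem_erase hJ
        have hne := Finset.ne_of_mem_erase hJ
        have hxa : x ≠ a := by
          rintro rfl; exact hne (hu J ⟨hJ', hx⟩)
        have hxI := h2 J hJ' hx
        have hxK : x ∈ K := (Finset.mem_insert.1 hxI).resolve_left hxa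
        refine Finset.mem_sdiff.2 ⟨hxK, fun hxB => hne ?_⟩
        exact (h3 x hxI).unique ⟨hJ', hx⟩ ⟨hB, Finset.mem_of_mem_erase hxB⟩
      · intro x hx
        obtain ⟨hxK, hxB⟩ := Finset.mem_sdiff.1 hx
        have hxa : x ≠ a := by rintro rfl; exact ha hxK
        obtain ⟨J, ⟨hJ, hxJ⟩, hu'⟩ := h3 x (Finset.mem_insert_of_mem hxK)
        refine ⟨J, ⟨Finset.mem_erase.2 ⟨?_, hJ⟩, hxJ⟩, ?_⟩
        · rintro rfl; exact hxB (Finset.mem_erase.2 ⟨hxa, hxJ⟩)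
        · rintro J' ⟨hJ', hxJ'⟩
          exact hu' J' ⟨Finset.mem_of_mem_erase hJ', hxJ'⟩
    · simp only [Finset.insert_erase haB, Finset.insert_erase hB]
  · rintro ⟨L, Q⟩ hx
    rw [Finset.mem_sigma] at hx
    have hk := key L hx.1 Q hx.2
    have n1 : insert a L ∉ Q := fun h => hk _ h (Finset.mem_insert_self _ _)
    simp only [Finset.prod_insert n1]

lemma EL_one {m : ℕ} (α : Fin m → ℝ) (hα : ∀ j, 0 < α j) : EL α hα 1 = 1 := by
  change EI α (MvPolynomial.monomial 0 1) = 1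
  rw [EI_mon α hα]
  simp [fun j => div_self (Real.Gamma_pos_of_pos (hα j)).ne']

lemma EL_eq {n m : ℕ} (α : Fin m → ℝ) (hα : ∀ j, 0 < α j) (β : Fin n → Fin m → ℝ)
    (K : Finset (Fin n)) :
    EL α hα (∏ i ∈ K, lf β i) = ∑ pp ∈ Pt K, ∏ J ∈ pp,
      ((J.card - 1).factorial : ℝ) * ∑ j, α j * ∏ i ∈ J, β i j := by
  induction K using Finset.strongInduction with
  | H K ih =>
    rcases K.eq_empty_or_nonempty with rfl | ⟨a, haK⟩
    · simp [Pt_empty, EL_one]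
    · obtain ⟨K', ha, rfl⟩ : ∃ K', a ∉ K' ∧ K = insert a K' :=
        ⟨K.erase a, by simp, (Finset.insert_erase haK).symm⟩
      rw [Pt_rec _ _ ha, Finset.prod_insert ha]
      conv_lhs => rw [lf, Finset.sum_mul, map_sum]
      simp only [smul_mul_assoc, map_smul, EL_sub, smul_eq_mul, Finset.mul_sum (s := K'.powerset)]
      rw [Finset.sum_comm]
      refine Finset.sum_congr rfl fun L hL => ?_
      have haL : a ∉ L := fun h => ha (Finset.mem_powerset.1 hL h)
      rw [← ih (K' \ L) (Finset.ssubset_of_subset_of_ssubset Finset.sdiff_subset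
        (Finset.ssubset_insert ha)), Finset.card_insert_of_notMem haL, Finset.mul_sum, Finset.sum_mul]
      refine Finset.sum_congr rfl fun j _ => ?_
      rw [Finset.prod_insert haL, Nat.add_sub_cancel]
      ring

theorem ptilde_eq_sum_partitions (n m : ℕ) (hn : 1 ≤ n) (hm : 1 ≤ m)
    (α : Fin m → ℝ) (hα : ∀ j, 0 < α j) (β : Fin n → Fin m → ℝ) :
    ptilde n m α β Finset.univ
      = ∑ P : Finpartition (Finset.univ : Finset (Fin n)),
          ∏ J ∈ P.parts,
            ((J.card - 1).factorial : ℝ) * ∑ j, α j * ∏ i ∈ J, β i j := by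
  rw [sum_Pt Finset.univ (fun J => ((J.card - 1).factorial : ℝ) * ∑ j, α j * ∏ i ∈ J, β i j),
    ← EL_eq α hα β]
  change _ = EI α _
  simp [ptilde, EI, gdens, lf, MvPolynomial.eval_prod, MvPolynomial.smul_eval]
end

section
/- Let n ≥ 1 and M ≥ 2^n − 1 be integers, and let α : Fin M → ℝ with α j > 0 for all j. Let 𝒫 := {J ⊆ Fin n : J ≠ ∅} (so |𝒫| = 2^n − 1), and define μ : (Fin n → Fin M → ℝ) → (𝒫 → ℝ) by μ(β)_J := ∑_{j=1}^M α_j · ∏_{i∈J} β i j. Let D := {β : β i j > 0 for all i, j, and ∑_{i=1}^n β i j < 1 for all j}. Then μ(D) contains a nonempty open subset of ℝ^𝒫; in particular the Hausdorff dimension of μ(D) equals 2^n − 1. -/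
open Finset

def mmExp {n : ℕ} (J : Finset (Fin n)) : ℕ := ∑ i ∈ J, 2 ^ (i : ℕ)

lemma mmExp_eq {n : ℕ} (J : Finset (Fin n)) :
    mmExp J = ∑ k ∈ J.map Fin.valEmbedding, 2 ^ k := by
  simp [mmExp]

lemma mmExp_inj {n : ℕ} {J K : Finset (Fin n)} (h : mmExp J = mmExp K) : J = K := by
  rw [mmExp_eq, mmExp_eq] at h
  exact Finset.map_injective _ (Finset.geomSum_injective le_rfl h)

lemma mmExp_lt {n : ℕ} (J : Finset (Fin n)) : mmExp J < 2 ^ n := by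
  rw [mmExp_eq]
  apply Nat.geomSum_lt le_rfl
  intro k hk
  simp only [Finset.mem_map] at hk
  obtain ⟨i, -, rfl⟩ := hk
  exact i.2

lemma mmExp_pos {n : ℕ} (J : Finset (Fin n)) (h : J.Nonempty) : 0 < mmExp J :=
  Finset.sum_pos (fun _ _ => by positivity) h

/-- derivative of the restricted moment map -/
noncomputable def mmL (n M : ℕ) (α : Fin M → ℝ) (c : ℝ) (t : Fin M → ℝ) :
    (Fin M → ℝ) →L[ℝ] ({J : Finset (Fin n) // J.Nonempty} → ℝ) :=
  ContinuousLinearMap.pi fun J => ∑ j, (α j * c ^ J.1.card * (mmExp J.1 * t j ^ (mmExp J.1 - 1))) •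
    (ContinuousLinearMap.proj j : (Fin M → ℝ) →L[ℝ] ℝ)

lemma mm_strict (n M : ℕ) (α : Fin M → ℝ) (c : ℝ) (t : Fin M → ℝ) :
    HasStrictFDerivAt (fun (t : Fin M → ℝ) (J : {J : Finset (Fin n) // J.Nonempty}) =>
      ∑ j, α j * c ^ J.1.card * t j ^ mmExp J.1) (mmL n M α c t) t := by
  unfold mmL
  rw [hasStrictFDerivAt_pi]
  intro J
  apply HasStrictFDerivAt.fun_sum
  intro j _
  have h := ((hasStrictDerivAt_pow (mmExp J.1) (t j)).const_mul
    (α j * c ^ J.1.card)).comp_hasStrictFDerivAt t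
    (ContinuousLinearMap.proj j : (Fin M → ℝ) →L[ℝ] ℝ).hasStrictFDerivAt
  exact h

lemma mm_surj (n M : ℕ) (hM : 2 ^ n - 1 ≤ M) (α : Fin M → ℝ) (hα : ∀ j, 0 < α j)
    (c : ℝ) (hc : 0 < c) (t : Fin M → ℝ) (ht : Function.Injective t) :
    (mmL n M α c t).range = ⊤ := by
  by_contra hne
  obtain ⟨f, hf, hle⟩ := Submodule.exists_le_ker_of_lt_top _ (lt_top_iff_ne_top.2 hne)
  apply hf
  let a : {J : Finset (Fin n) // J.Nonempty} → ℝ := fun J => f (Pi.single J 1)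
  have hfa : ∀ v, f v = ∑ J, v J * a J := by
    intro v
    rw [LinearMap.pi_apply_eq_sum_univ f v]
    refine Finset.sum_congr rfl fun J _ => ?_
    simp only [smul_eq_mul, a]
    congr 2
    ext K
    simp [Pi.single_apply, eq_comm]
  let p : Polynomial ℝ := ∑ J : {J : Finset (Fin n) // J.Nonempty},
    Polynomial.monomial (mmExp J.1 - 1) (a J * c ^ J.1.card * mmExp J.1)
  have hp : p = 0 := by
    apply Polynomial.eq_zero_of_natDegree_lt_card_of_eval_eq_zero p ht
    · intro j
      have h0 : f (mmL n M α c t (Pi.single j 1)) = 0 := hle ⟨_, rfl⟩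
      rw [hfa] at h0
      have h1 : α j * p.eval (t j) = 0 := by
        rw [← h0]
        simp only [p, Polynomial.eval_finsetSum, Polynomial.eval_monomial, Finset.mul_sum]
        refine Finset.sum_congr rfl fun J _ => ?_
        simp [mmL, Pi.single_apply]
        ring
      exact (mul_eq_zero.1 h1).resolve_left (hα j).ne'
    · rw [Fintype.card_fin]
      have h2 : ∀ J : {J : Finset (Fin n) // J.Nonempty}, mmExp J.1 - 1 ≤ 2 ^ n - 2 := by
        intro J; have := mmExp_lt J.1; omega
      have : p.natDegree ≤ 2 ^ n - 2 := by
        apply Polynomial.natDegree_sum_le_of_forall_le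
        intro J _
        exact (Polynomial.natDegree_monomial_le _).trans (h2 J)
      rcases isEmpty_or_nonempty {J : Finset (Fin n) // J.Nonempty} with he | ⟨⟨J⟩⟩
      · exfalso
        apply hf
        ext v
        exact he.elim v
      · have h3 := mmExp_lt J.1
        have h4 := mmExp_pos J.1 J.2
        omega
  have ha : ∀ J, a J = 0 := by
    intro J
    have h := congrArg (fun q => Polynomial.coeff q (mmExp J.1 - 1)) hp
    simp only [p, Polynomial.finsetSum_coeff, Polynomial.coeff_monomial,
      Polynomial.coeff_zero] at h
    rw [Finset.sum_eq_single J] at h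
    · have h4 := mmExp_pos J.1 J.2
      have h5 : (mmExp J.1 : ℝ) ≠ 0 := by positivity
      simpa [h5, hc.ne'] using h
    · intro K _ hK
      rw [if_neg]
      intro h
      have h4 := mmExp_pos J.1 J.2
      have h5 := mmExp_pos K.1 K.2
      exact hK (Subtype.ext (mmExp_inj (by omega)))
    · simp
  apply LinearMap.ext
  intro v
  rw [hfa]
  simp [ha]

theorem mixed_moments_full_dimensional (n M : ℕ) (hn : 1 ≤ n)
    (hM : 2 ^ n - 1 ≤ M) (α : Fin M → ℝ) (hα : ∀ j, 0 < α j) :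
    let μ : (Fin n → Fin M → ℝ) → ({J : Finset (Fin n) // J.Nonempty} → ℝ) :=
      fun β J => ∑ j, α j * ∏ i ∈ J.1, β i j
    let D : Set (Fin n → Fin M → ℝ) :=
      {β | (∀ i j, 0 < β i j) ∧ ∀ j, ∑ i, β i j < 1}
    (∃ U : Set ({J : Finset (Fin n) // J.Nonempty} → ℝ),
        IsOpen U ∧ U.Nonempty ∧ U ⊆ μ '' D) ∧
      dimH (μ '' D) = ((2 ^ n - 1 : ℕ) : ENNReal) := by
  intro μ D
  have hint : (interior (μ '' D)).Nonempty := by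
    let c : ℝ := 1 / (n + 1)
    have hc : 0 < c := by positivity
    let t : Fin M → ℝ := fun j => ((j : ℕ) + 1) / (M + 1)
    have ht : Function.Injective t := by
      intro j k h
      have hM0 : (M + 1 : ℝ) ≠ 0 := by positivity
      have h' : ((j : ℕ) + 1 : ℝ) = (k : ℕ) + 1 := by
        simpa only [t, div_left_inj' hM0] using h
      exact Fin.ext (by exact_mod_cast add_right_cancel h')
    have hmap := (mm_strict n M α c t).map_nhds_eq_of_surj (mm_surj n M hM α hα c hc t ht)
    let T : Set (Fin M → ℝ) := Set.univ.pi fun _ => Set.Ioo 0 1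
    have hT : T ∈ nhds t := by
      apply (isOpen_set_pi Set.finite_univ (fun _ _ => isOpen_Ioo)).mem_nhds
      intro j _
      have : ((j : ℕ) + 1 : ℝ) ≤ M := by exact_mod_cast j.2
      refine ⟨by positivity, ?_⟩
      rw [div_lt_one (by positivity)]
      linarith
    have himg := Filter.image_mem_map
      (m := (fun (t : Fin M → ℝ) (J : {J : Finset (Fin n) // J.Nonempty}) =>
      ∑ j, α j * c ^ J.1.card * t j ^ mmExp J.1)) hT
    rw [hmap] at himg
    refine ⟨_, mem_interior_iff_mem_nhds.2 (Filter.mem_of_superset himg ?_)⟩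
    rintro _ ⟨s, hs, rfl⟩
    refine ⟨fun i j => c * s j ^ (2 ^ (i : ℕ)), ⟨fun i j => ?_, fun j => ?_⟩, ?_⟩
    · have := (hs j trivial).1
      positivity
    · have h0 := (hs j trivial).1
      have h1 := (hs j trivial).2
      calc ∑ i : Fin n, c * s j ^ (2 ^ (i : ℕ)) ≤ ∑ i : Fin n, c := by
            apply Finset.sum_le_sum
            intro i _
            have := pow_le_one₀ (n := 2 ^ (i : ℕ)) h0.le h1.le
            nlinarith
        _ < 1 := by
            simp only [Finset.sum_const, Finset.card_univ, Fintype.card_fin, nsmul_eq_mul, c]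
            rw [mul_one_div, div_lt_one (by positivity)]
            linarith
    · funext J
      simp only [μ, Finset.prod_mul_distrib, Finset.prod_const, Finset.prod_pow_eq_pow_sum,
        mmExp, mul_assoc]
  refine ⟨⟨interior (μ '' D), isOpen_interior, hint, interior_subset⟩, ?_⟩
  rw [Real.dimH_of_nonempty_interior hint, Module.finrank_fintype_fun_eq_card]
  congr 1
  have h : Fintype.card {J : Finset (Fin n) // J.Nonempty} =
      Fintype.card {J : Finset (Fin n) // ¬ J = ∅} :=
    Fintype.card_congr (Equiv.subtypeEquivRight fun J => Finset.nonempty_iff_ne_empty)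
  rw [h, Fintype.card_subtype_compl]
  simp
end

section
/- For every n ≥ 1 and every real n × n matrix B, ∑_{π ∈ Part(Fin n)} (−1)^{n − |π|} · ∏_{J ∈ π} ((|J| − 1)! · ∑_{j ∈ Fin n} ∏_{i ∈ J} B i j) = ∑_{σ ∈ Perm(Fin n)} ∏_{i ∈ Fin n} B i (σ i), where |π| is the number of blocks of π; that is, the left-hand side equals the permanent of B. (This is the identity obtained by evaluating the partition formula for p̃ at α(z) = −1 for every cause, which underlies the reduction from the permanent.) -/
open Finset

namespace PermAux

variable {α β : Type} [Fintype α] [DecidableEq α] [Fintype β] [DecidableEq β]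

def IsP (s : Finset α) (C : Finset (Finset α)) : Prop :=
  (∀ t ∈ C, ∀ x ∈ t, x ∈ s) ∧ (∀ x ∈ s, ∃ t ∈ C, x ∈ t) ∧
  (∀ t ∈ C, ∀ u ∈ C, ∀ x, x ∈ t → x ∈ u → t = u) ∧ ∅ ∉ C

open Classical in
noncomputable def PF (s : Finset α) : Finset (Finset (Finset α)) := univ.filter (IsP s)

theorem mem_PF {s : Finset α} {C : Finset (Finset α)} : C ∈ PF s ↔ IsP s C := by
  simp [PF]

theorem isP_fwd {s : Finset α} {a : α} (ha : a ∉ s) {C : Finset (Finset α)} (hC : IsP s C)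
    {J : Finset α} (hJ : J ∈ insert ∅ C) : IsP (insert a s) (insert (insert a J) (C.erase J)) := by
  obtain ⟨h1, h2, h3, h4⟩ := hC
  have hJs : ∀ x ∈ J, x ∈ s := by
    intro x hx
    rcases Finset.mem_insert.1 hJ with rfl | h
    · simp at hx
    · exact h1 J h x hx
  have hJ3 : ∀ u ∈ C, ∀ x, x ∈ J → x ∈ u → J = u := by
    intro u hu x hx hxu
    rcases Finset.mem_insert.1 hJ with rfl | h
    · simp at hx
    · exact h3 J h u hu x hx hxu
  refine ⟨?_, ?_, ?_, ?_⟩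
  · intro t ht x hx
    grind
  · intro x hx
    by_cases hxa : x = a
    · exact ⟨insert a J, by simp, by simp [hxa]⟩
    · have hxs : x ∈ s := by grind
      obtain ⟨t, ht, hxt⟩ := h2 x hxs
      by_cases htJ : t = J
      · exact ⟨insert a J, by simp, by grind⟩
      · exact ⟨t, by grind, hxt⟩
  · intro t ht u hu x hxt hxu
    have h5 : ∀ u ∈ C.erase J, ∀ x, x ∈ insert a J → x ∈ u → False := by
      intro u hu x hx hxu
      have huC := Finset.mem_of_mem_erase hu
      have hne := Finset.ne_of_mem_erase hu
      rcases Finset.mem_insert.1 hx with rfl | hx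
      · exact ha (h1 u huC _ hxu)
      · exact hne (hJ3 u huC x hx hxu).symm
    rcases Finset.mem_insert.1 ht with rfl | ht' <;> rcases Finset.mem_insert.1 hu with rfl | hu'
    · rfl
    · exact (h5 u hu' x hxt hxu).elim
    · exact (h5 t ht' x hxu hxt).elim
    · exact h3 t (Finset.mem_of_mem_erase ht') u (Finset.mem_of_mem_erase hu') x hxt hxu
  · intro h
    rcases Finset.mem_insert.1 h with h | h
    · exact (Finset.insert_ne_empty a J) h.symm
    · exact h4 (Finset.mem_of_mem_erase h)

theorem isP_bwd {s : Finset α} {a : α} (ha : a ∉ s) {D : Finset (Finset α)}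
    (hD : IsP (insert a s) D) {K : Finset α} (hK : K ∈ D) (haK : a ∈ K) :
    IsP s ((insert (K.erase a) (D.erase K)).erase ∅) := by
  obtain ⟨h1, h2, h3, h4⟩ := hD
  have hK3 := h3 K hK
  refine ⟨?_, ?_, ?_, ?_⟩
  · intro t ht x hx
    rcases Finset.mem_insert.1 (Finset.mem_of_mem_erase ht) with rfl | ht'
    · have := h1 K hK x (Finset.mem_of_mem_erase hx)
      grind
    · have hxa : x ≠ a := by
        rintro rfl
        exact (Finset.ne_of_mem_erase ht') (hK3 t (Finset.mem_of_mem_erase ht') x haK hx).symm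
      have := h1 t (Finset.mem_of_mem_erase ht') x hx
      grind
  · intro x hx
    obtain ⟨t, ht, hxt⟩ := h2 x (Finset.mem_insert_of_mem hx)
    have hxa : x ≠ a := by rintro rfl; exact ha hx
    by_cases htK : t = K
    · exact ⟨K.erase a, by grind, by grind⟩
    · exact ⟨t, by grind, hxt⟩
  · intro t ht u hu x hxt hxu
    have ht := Finset.mem_of_mem_erase ht
    have hu := Finset.mem_of_mem_erase hu
    have h5 : ∀ u ∈ D.erase K, ∀ x, x ∈ K.erase a → x ∈ u → False := by
      intro u hu x hx hxu
      exact (Finset.ne_of_mem_erase hu)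
        (hK3 u (Finset.mem_of_mem_erase hu) x (Finset.mem_of_mem_erase hx) hxu).symm
    rcases Finset.mem_insert.1 ht with rfl | ht' <;> rcases Finset.mem_insert.1 hu with rfl | hu'
    · rfl
    · exact (h5 u hu' x hxt hxu).elim
    · exact (h5 t ht' x hxu hxt).elim
    · exact h3 t (Finset.mem_of_mem_erase ht') u (Finset.mem_of_mem_erase hu') x hxt hxu
  · simp

theorem sum_PF_insert (s : Finset α) (a : α) (ha : a ∉ s) (w : Finset α → ℝ) :
    ∑ C ∈ PF (insert a s), ∏ J ∈ C, w J
      = ∑ C ∈ PF s, ∑ J ∈ insert ∅ C, w (insert a J) * ∏ K ∈ C.erase J, w K := by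
  rw [Finset.sum_sigma']
  symm
  refine Finset.sum_bij (fun p _ => insert (insert a p.2) (p.1.erase p.2)) ?_ ?_ ?_ ?_
  · rintro ⟨C, J⟩ h
    rw [Finset.mem_sigma, mem_PF] at h
    exact mem_PF.2 (isP_fwd ha h.1 h.2)
  · rintro ⟨C, J⟩ h ⟨C', J'⟩ h' heq
    rw [Finset.mem_sigma, mem_PF] at h h'
    obtain ⟨hC, hJ⟩ := h
    obtain ⟨hC', hJ'⟩ := h'
    simp only at hC hJ hC' hJ' heq
    have key : ∀ C : Finset (Finset α), IsP s C → ∀ t ∈ C, a ∉ t :=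
      fun C hC t ht hat => ha (hC.1 t ht a hat)
    have kJ : ∀ C : Finset (Finset α), IsP s C → ∀ t ∈ insert ∅ C, a ∉ t := by
      intro C hC t ht
      rcases Finset.mem_insert.1 ht with rfl | h
      · simp
      · exact key C hC t h
    have hI : insert a J = insert a J' := by
      have : insert a J ∈ insert (insert a J') (C'.erase J') := by rw [← heq]; simp
      rcases Finset.mem_insert.1 this with h | h
      · exact h
      · exact (key C' hC' _ (Finset.mem_of_mem_erase h) (by simp)).elim
    have hJJ : J = J' := by
      have := congrArg (fun t => Finset.erase t a) hI
      simpa [Finset.erase_insert (kJ C hC J hJ), Finset.erase_insert (kJ C' hC' J' hJ')] using this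
    subst hJJ
    have hE : C.erase J = C'.erase J := by
      have := congrArg (fun t => Finset.erase t (insert a J)) heq
      rwa [Finset.erase_insert, Finset.erase_insert] at this
      · exact fun h => key C' hC' _ (Finset.mem_of_mem_erase h) (by simp)
      · exact fun h => key C hC _ (Finset.mem_of_mem_erase h) (by simp)
    have hCC : C = C' := by
      have e1 := hC.2.2.2
      have e2 := hC'.2.2.2
      by_cases hJe : J = ∅
      · subst hJe
        rwa [Finset.erase_eq_of_notMem e1, Finset.erase_eq_of_notMem e2] at hE
      · have m1 : J ∈ C := by grind
        have m2 : J ∈ C' := by grind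
        rw [← Finset.insert_erase m1, ← Finset.insert_erase m2, hE]
    subst hCC
    rfl
  · intro D hD
    rw [mem_PF] at hD
    obtain ⟨K, hK, haK⟩ := hD.2.1 a (by simp)
    have hne : K.erase a ∉ D.erase K := by
      intro h
      have h' := Finset.mem_of_mem_erase h
      by_cases he : K.erase a = ∅
      · exact hD.2.2.2 (he ▸ h')
      · obtain ⟨x, hx⟩ := Finset.nonempty_iff_ne_empty.2 he
        exact Finset.ne_of_mem_erase h (hD.2.2.1 _ h' K hK x hx (Finset.mem_of_mem_erase hx))
    have h4 := hD.2.2.2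
    refine ⟨⟨(insert (K.erase a) (D.erase K)).erase ∅, K.erase a⟩, ?_, ?_⟩
    · rw [Finset.mem_sigma, mem_PF]
      refine ⟨isP_bwd ha hD hK haK, ?_⟩
      by_cases he : K.erase a = ∅
      · simp [he]
      · simp [he]
    · simp only
      rw [Finset.insert_erase haK, Finset.erase_right_comm, Finset.erase_insert hne,
        Finset.erase_eq_of_notMem (fun h => h4 (Finset.mem_of_mem_erase h)),
        Finset.insert_erase hK]
  · rintro ⟨C, J⟩ h
    rw [Finset.mem_sigma, mem_PF] at h
    simp only at h ⊢
    rw [Finset.prod_insert]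
    exact fun h' => ha (h.1.1 _ (Finset.mem_of_mem_erase h') a (by simp))

noncomputable def w (B : α → β → ℝ) (J : Finset α) : ℝ :=
  (-1) ^ (J.card - 1) * (((J.card - 1).factorial : ℝ) * ∑ j, ∏ i ∈ J, B i j)

def mrg (B : α → β → ℝ) (a i : α) : α → β → ℝ :=
  Function.update B i (fun j => B a j * B i j)

theorem w_mrg_of_notMem (B : α → β → ℝ) (a i : α) (K : Finset α) (h : i ∉ K) :
    w (mrg B a i) K = w B K := by
  unfold w
  congr 2
  refine Finset.sum_congr rfl fun j _ => Finset.prod_congr rfl fun k hk => ?_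
  have : k ≠ i := by rintro rfl; exact h hk
  simp [mrg, this]

theorem prod_mrg (B : α → β → ℝ) (a i : α) (J : Finset α) (h : i ∈ J) (f : α → β) :
    ∏ k ∈ J, mrg B a i k (f k) = B a (f i) * ∏ k ∈ J, B k (f k) := by
  rw [← Finset.mul_prod_erase J _ h, ← Finset.mul_prod_erase J (fun k => B k (f k)) h, ← mul_assoc]
  congr 1
  · simp [mrg]
  · refine Finset.prod_congr rfl fun k hk => ?_
    simp [mrg, Finset.ne_of_mem_erase hk]

theorem w_insert (B : α → β → ℝ) (a : α) (J : Finset α) (ha : a ∉ J) (hJ : J.Nonempty) :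
    w B (insert a J) = -∑ i ∈ J, w (mrg B a i) J := by
  have h1 : ∀ i ∈ J, w (mrg B a i) J = (-1) ^ (J.card - 1) * (((J.card - 1).factorial : ℝ) *
      ∑ j, ∏ k ∈ insert a J, B k j) := by
    intro i hi
    unfold w
    congr 2
    refine Finset.sum_congr rfl fun j _ => ?_
    rw [prod_mrg B a i J hi (fun _ => j), Finset.prod_insert ha]
  rw [Finset.sum_congr rfl h1, Finset.sum_const, nsmul_eq_mul]
  unfold w
  rw [Finset.card_insert_of_notMem ha]
  obtain ⟨m, hm⟩ : ∃ m, J.card = m + 1 := ⟨J.card - 1, by have := hJ.card_pos; omega⟩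
  rw [hm]
  simp only [Nat.add_sub_cancel, Nat.factorial_succ]
  push_cast
  ring

noncomputable def F (B : α → β → ℝ) (s : Finset α) : ℝ := ∑ C ∈ PF s, ∏ J ∈ C, w B J

theorem F_insert (B : α → β → ℝ) (s : Finset α) (a : α) (ha : a ∉ s) :
    F B (insert a s) = (∑ j, B a j) * F B s - ∑ i ∈ s, F (mrg B a i) s := by
  unfold F
  rw [sum_PF_insert s a ha, Finset.sum_comm (s := s), Finset.mul_sum, ← Finset.sum_sub_distrib]
  refine Finset.sum_congr rfl fun C hC => ?_
  obtain ⟨h1, h2, h3, h4⟩ := mem_PF.1 hC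
  rw [Finset.sum_insert h4, Finset.erase_eq_of_notMem h4, sub_eq_add_neg]
  congr 1
  · simp [w]
  · have hs : s = C.biUnion id := by
      ext x
      simp only [Finset.mem_biUnion, id]
      exact ⟨fun h => h2 x h, fun ⟨t, ht, hx⟩ => h1 t ht x hx⟩
    have hd : (C : Set (Finset α)).PairwiseDisjoint id := by
      intro t ht u hu htu
      refine Finset.disjoint_left.2 fun x hx hx' => htu (h3 t ht u hu x hx hx')
    rw [hs, Finset.sum_biUnion hd, ← Finset.sum_neg_distrib]
    refine Finset.sum_congr rfl fun J hJ => ?_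
    rw [w_insert B a J (fun h => ha (h1 J hJ a h))
      (Finset.nonempty_iff_ne_empty.2 fun h => h4 (h ▸ hJ)), neg_mul, Finset.sum_mul]
    congr 1
    refine Finset.sum_congr rfl fun i hi => ?_
    rw [← Finset.mul_prod_erase C _ hJ]
    congr 1
    refine Finset.prod_congr rfl fun K hK => ?_
    rw [w_mrg_of_notMem]
    intro hiK
    exact Finset.ne_of_mem_erase hK (h3 K (Finset.mem_of_mem_erase hK) J hJ i hiK hi)

open Classical in
noncomputable def S (b : β) (s : Finset α) : Finset (α → β) :=
  univ.filter fun f => Set.InjOn f s ∧ ∀ x, x ∉ s → f x = b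

theorem mem_S {b : β} {s : Finset α} {f : α → β} :
    f ∈ S b s ↔ Set.InjOn f s ∧ ∀ x, x ∉ s → f x = b := by
  simp [S]

noncomputable def G (b : β) (B : α → β → ℝ) (s : Finset α) : ℝ := ∑ f ∈ S b s, ∏ i ∈ s, B i (f i)

theorem G_insert (b : β) (B : α → β → ℝ) (s : Finset α) (a : α) (ha : a ∉ s) :
    G b B (insert a s) = (∑ j, B a j) * G b B s - ∑ i ∈ s, G b (mrg B a i) s := by
  have e1 : G b B (insert a s)
      = ∑ f ∈ S b s, ∑ j ∈ univ \ s.image f, B a j * ∏ i ∈ s, B i (f i) := by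
    unfold G
    rw [Finset.sum_sigma']
    refine Finset.sum_bij' (fun f _ => ⟨Function.update f a b, f a⟩)
      (fun p _ => Function.update p.1 a p.2) ?_ ?_ ?_ ?_ ?_
    · intro f hf
      obtain ⟨h1, h2⟩ := mem_S.1 hf
      rw [Finset.mem_sigma, mem_S]
      refine ⟨⟨?_, ?_⟩, ?_⟩
      · intro x hx y hy hxy
        have hxa : x ≠ a := by rintro rfl; exact ha hx
        have hya : y ≠ a := by rintro rfl; exact ha hy
        simp only [Function.update_of_ne hxa, Function.update_of_ne hya] at hxy
        exact h1 (by simpa using Or.inr hx) (by simpa using Or.inr hy) hxy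
      · intro x hx
        by_cases hxa : x = a
        · simp [hxa]
        · simp only [Function.update_of_ne hxa]
          exact h2 x (by simp [hx, hxa])
      · simp only [Finset.mem_sdiff, Finset.mem_univ, true_and, Finset.mem_image, not_exists, not_and]
        intro x hx hxf
        have hxa : x ≠ a := by rintro rfl; exact ha hx
        rw [Function.update_of_ne hxa] at hxf
        exact hxa (h1 (by simpa using Or.inr hx) (by simp) hxf)
    · rintro ⟨f, j⟩ hp
      rw [Finset.mem_sigma, mem_S] at hp
      obtain ⟨⟨h1, h2⟩, h3⟩ := hp
      simp only [Finset.mem_sdiff, Finset.mem_univ, true_and, Finset.mem_image, not_exists, not_and] at h1 h2 h3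
      rw [mem_S]
      refine ⟨?_, ?_⟩
      · rw [Finset.coe_insert, Set.injOn_insert (by simpa using ha)]
        refine ⟨?_, ?_⟩
        · intro x hx y hy hxy
          have hxa : x ≠ a := by rintro rfl; exact ha hx
          have hya : y ≠ a := by rintro rfl; exact ha hy
          simp only [Function.update_of_ne hxa, Function.update_of_ne hya] at hxy
          exact h1 hx hy hxy
        · rintro ⟨x, hx, hxy⟩
          have hxa : x ≠ a := by rintro rfl; exact ha hx
          simp only [Function.update_of_ne hxa, Function.update_self] at hxy
          exact h3 x hx hxy
      · intro x hx
        have hxa : x ≠ a := by rintro rfl; exact hx (by simp)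
        simp only [Function.update_of_ne hxa]
        exact h2 x (fun h => hx (by simp [h]))
    · intro f hf
      simp
    · rintro ⟨f, j⟩ hp
      rw [Finset.mem_sigma, mem_S] at hp
      have : f a = b := hp.1.2 a ha
      simp [← this]
    · intro f hf
      rw [Finset.prod_insert ha]
      simp only
      congr 1
      refine Finset.prod_congr rfl fun x hx => ?_
      have hxa : x ≠ a := by rintro rfl; exact ha hx
      rw [Function.update_of_ne hxa]
  rw [e1]
  unfold G
  rw [Finset.sum_comm (s := s), Finset.mul_sum, ← Finset.sum_sub_distrib]
  refine Finset.sum_congr rfl fun f hf => ?_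
  rw [Finset.sum_sdiff_eq_sub (Finset.subset_univ _), Finset.sum_mul, Finset.sum_image (mem_S.1 hf).1]
  congr 1
  exact Finset.sum_congr rfl fun i hi => (prod_mrg B a i s hi f).symm

theorem F_eq_G (b : β) (s : Finset α) : ∀ B : α → β → ℝ, F B s = G b B s := by
  induction s using Finset.induction_on with
  | empty =>
    intro B
    have h1 : PF (∅ : Finset α) = {∅} := by
      ext C
      rw [mem_PF, Finset.mem_singleton]
      constructor
      · rintro ⟨h1, -, -, h4⟩
        rw [Finset.eq_empty_iff_forall_notMem]
        intro t ht
        have : t = ∅ := Finset.eq_empty_iff_forall_notMem.2 fun x hx => by simpa using h1 t ht x hx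
        exact h4 (this ▸ ht)
      · rintro rfl
        simp [IsP]
    have h2 : S b (∅ : Finset α) = {fun _ => b} := by
      ext f
      rw [mem_S, Finset.mem_singleton, funext_iff]
      simp
    simp [F, G, h1, h2]
  | insert a s ha ih =>
    intro B
    rw [F_insert B s a ha, G_insert b B s a ha, ih]
    simp only [ih]

end PermAux

open PermAux in
theorem partition_formula_eq_permanent (n : ℕ) (hn : 1 ≤ n)
    (B : Fin n → Fin n → ℝ) :
    ∑ P : Finpartition (Finset.univ : Finset (Fin n)),
        (-1 : ℝ) ^ (n - P.parts.card) *
          ∏ J ∈ P.parts,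
            ((J.card - 1).factorial : ℝ) * ∑ j, ∏ i ∈ J, B i j
      = ∑ σ : Equiv.Perm (Fin n), ∏ i, B i (σ i) := by
  have hF : ∑ P : Finpartition (Finset.univ : Finset (Fin n)),
        (-1 : ℝ) ^ (n - P.parts.card) *
          ∏ J ∈ P.parts,
            ((J.card - 1).factorial : ℝ) * ∑ j, ∏ i ∈ J, B i j = F B univ := by
    unfold F
    refine Finset.sum_bij (fun P _ => P.parts) ?_ ?_ ?_ ?_
    · intro P _
      rw [mem_PF]
      refine ⟨fun _ _ _ _ => Finset.mem_univ _, fun x hx => P.exists_mem hx, ?_,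
        P.empty_notMem_parts⟩
      intro t ht u hu x hxt hxu
      exact P.eq_of_mem_parts ht hu hxt hxu
    · intro P _ Q _ h
      exact Finpartition.ext h
    · intro C hC
      obtain ⟨h1, h2, h3, h4⟩ := mem_PF.1 hC
      refine ⟨Finpartition.ofExistsUnique C (fun _ _ => Finset.subset_univ _) ?_ h4,
        Finset.mem_univ _, rfl⟩
      intro x hx
      obtain ⟨t, ht, hxt⟩ := h2 x hx
      exact ⟨t, ⟨ht, hxt⟩, fun u hu => h3 u hu.1 t ht x hu.2 hxt⟩
    · intro P _
      simp only [w]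
      rw [Finset.prod_mul_distrib (s := P.parts) (f := fun J => (-1 : ℝ) ^ (J.card - 1)),
        Finset.prod_pow_eq_pow_sum]
      congr 2
      have h := P.sum_card_parts
      rw [Finset.card_univ, Fintype.card_fin] at h
      have h' : ∑ J ∈ P.parts, J.card = ∑ J ∈ P.parts, (J.card - 1) + P.parts.card := by
        rw [Finset.card_eq_sum_ones P.parts, ← Finset.sum_add_distrib]
        refine Finset.sum_congr rfl fun J hJ => ?_
        have := (P.nonempty_of_mem_parts hJ).card_pos
        omega
      omega
  rw [hF, F_eq_G (⟨0, hn⟩ : Fin n)]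
  unfold G
  symm
  refine Finset.sum_bij (fun σ _ => (σ : Fin n → Fin n)) ?_ ?_ ?_ ?_
  · intro σ _
    rw [mem_S]
    exact ⟨σ.injective.injOn, fun x hx => (hx (Finset.mem_univ x)).elim⟩
  · intro σ _ τ _ h
    exact DFunLike.coe_injective h
  · intro f hf
    have hi : Function.Injective f := by
      have := (mem_S.1 hf).1
      rwa [Finset.coe_univ, Set.injOn_univ] at this
    exact ⟨Equiv.ofBijective f (Finite.injective_iff_bijective.1 hi), Finset.mem_univ _, rfl⟩
  · intro σ _
    rfl
end

section
/- For every z ∈ Fin m, ∫_{(0,∞)^m} (∏_{j=1}^m θ_j^{α_j − 1} e^{−θ_j} / Γ(α_j)) · θ_z · ∏_{i=1}^n (∑_{j=1}^m β i j · θ_j) dθ = α_z · ∑_{J ⊆ Fin n} (∏_{i∈J} β i z) · |J|! · p̃(Fin n ∖ J). That is, the Gamma-product expectation of θ_z times the likelihood product expands as α_z times a sum over subsets J of observations, weighting ∏_{i∈J}β(w_i|z) by |J|! and the unnormalized probability of the remaining observations. -/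
open MeasureTheory Real Finset

noncomputable def gmE (m : ℕ) (α : Fin m → ℝ) (p : MvPolynomial (Fin m) ℝ) : ℝ :=
  ∫ θ : Fin m → ℝ in {θ | ∀ j, 0 < θ j},
    (∏ j, θ j ^ (α j - 1) * Real.exp (-θ j) / Real.Gamma (α j)) * MvPolynomial.eval θ p

lemma gm_restrict (m : ℕ) : (volume : Measure (Fin m → ℝ)).restrict {θ | ∀ j, 0 < θ j}
    = Measure.pi (fun _ => (volume : Measure ℝ).restrict (Set.Ioi 0)) := by
  rw [← Measure.restrict_pi_pi, volume_pi]
  congr 1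
  ext θ
  simp [Set.mem_pi]

lemma gm_one_integrable (a : ℝ) (ha : 0 < a) (k : ℕ) :
    Integrable (fun x : ℝ => x ^ (a - 1) * Real.exp (-x) / Real.Gamma a * x ^ k)
      (volume.restrict (Set.Ioi 0)) := by
  have h := (Real.GammaIntegral_convergent (s := a + k) (by positivity)).div_const (Real.Gamma a)
  refine IntegrableOn.congr_fun h ?_ measurableSet_Ioi
  intro x hx
  have hx : 0 < x := hx
  have : x ^ (a + k - 1) = x ^ (a - 1) * x ^ k := by
    rw [← Real.rpow_natCast x k, ← Real.rpow_add hx]; congr 1; ring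
  simp only [this]; ring

lemma gm_one_integral (a : ℝ) (ha : 0 < a) (k : ℕ) :
    ∫ x in Set.Ioi (0:ℝ), (x ^ (a - 1) * Real.exp (-x) / Real.Gamma a * x ^ k)
      = Real.Gamma (a + k) / Real.Gamma a := by
  rw [Real.Gamma_eq_integral (s := a + k) (by positivity), ← integral_div]
  refine setIntegral_congr_fun measurableSet_Ioi ?_
  intro x hx
  have hx : 0 < x := hx
  have : x ^ (a + k - 1) = x ^ (a - 1) * x ^ k := by
    rw [← Real.rpow_natCast x k, ← Real.rpow_add hx]; congr 1; ring
  simp only [this]; ring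

lemma gm_mono_eq (m : ℕ) (α : Fin m → ℝ) (s : Fin m →₀ ℕ) (c : ℝ) (θ : Fin m → ℝ) :
    (∏ j, θ j ^ (α j - 1) * Real.exp (-θ j) / Real.Gamma (α j)) *
      MvPolynomial.eval θ (MvPolynomial.monomial s c)
    = c * ∏ j, (θ j ^ (α j - 1) * Real.exp (-θ j) / Real.Gamma (α j) * θ j ^ s j) := by
  rw [MvPolynomial.eval_monomial, Finset.prod_mul_distrib, Finsupp.prod_fintype _ _ (by simp)]
  ring

lemma gm_integrable (m : ℕ) (α : Fin m → ℝ) (hα : ∀ j, 0 < α j) (p : MvPolynomial (Fin m) ℝ) :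
    Integrable (fun θ : Fin m → ℝ =>
      (∏ j, θ j ^ (α j - 1) * Real.exp (-θ j) / Real.Gamma (α j)) * MvPolynomial.eval θ p)
      ((volume : Measure (Fin m → ℝ)).restrict {θ | ∀ j, 0 < θ j}) := by
  induction p using MvPolynomial.induction_on' with
  | monomial s c =>
    simp only [gm_mono_eq]
    rw [gm_restrict]
    exact (Integrable.fintype_prod (fun j => gm_one_integrable (α j) (hα j) (s j))).const_mul c
  | add p q hp hq =>
    simp only [map_add, mul_add]
    exact hp.add hq

lemma gmE_add (m : ℕ) (α : Fin m → ℝ) (hα : ∀ j, 0 < α j) (p q : MvPolynomial (Fin m) ℝ) :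
    gmE m α (p + q) = gmE m α p + gmE m α q := by
  unfold gmE
  simp only [map_add, mul_add]
  exact integral_add (gm_integrable m α hα p) (gm_integrable m α hα q)

lemma gmE_smul (m : ℕ) (α : Fin m → ℝ) (c : ℝ) (p : MvPolynomial (Fin m) ℝ) :
    gmE m α (MvPolynomial.C c * p) = c * gmE m α p := by
  unfold gmE
  rw [← integral_const_mul]
  congr 1; ext θ
  simp only [map_mul, MvPolynomial.eval_C]; ring

lemma gmE_sum (m : ℕ) (α : Fin m → ℝ) (hα : ∀ j, 0 < α j) {ι : Type*} (s : Finset ι)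
    (f : ι → MvPolynomial (Fin m) ℝ) :
    gmE m α (∑ i ∈ s, f i) = ∑ i ∈ s, gmE m α (f i) := by
  classical
  induction s using Finset.induction_on with
  | empty => simp [gmE]
  | insert a s ha ih => rw [Finset.sum_insert ha, Finset.sum_insert ha, gmE_add m α hα, ih]

lemma gmE_monomial (m : ℕ) (α : Fin m → ℝ) (hα : ∀ j, 0 < α j) (s : Fin m →₀ ℕ) (c : ℝ) :
    gmE m α (MvPolynomial.monomial s c)
      = c * ∏ j, (Real.Gamma (α j + s j) / Real.Gamma (α j)) := by
  unfold gmE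
  simp only [gm_mono_eq]
  rw [integral_const_mul, gm_restrict, integral_fintype_prod_eq_prod
    (f := fun j (x : ℝ) => x ^ (α j - 1) * Real.exp (-x) / Real.Gamma (α j) * x ^ s j)]
  congr 1
  exact Finset.prod_congr rfl (fun j _ => gm_one_integral (α j) (hα j) (s j))

lemma gmE_stein (m : ℕ) (α : Fin m → ℝ) (hα : ∀ j, 0 < α j) (z : Fin m)
    (p : MvPolynomial (Fin m) ℝ) :
    gmE m α (MvPolynomial.X z * p)
      = α z * gmE m α p + gmE m α (MvPolynomial.X z * MvPolynomial.pderiv z p) := by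
  induction p using MvPolynomial.induction_on' with
  | monomial s c =>
    have h1 : MvPolynomial.X z * MvPolynomial.monomial s c
        = MvPolynomial.monomial (Finsupp.single z 1 + s) c := by
      rw [MvPolynomial.X, MvPolynomial.monomial_mul, one_mul]
    have h2 : (s z • MvPolynomial.monomial s c : MvPolynomial (Fin m) ℝ)
        = MvPolynomial.C (s z : ℝ) * MvPolynomial.monomial s c := by
      rw [nsmul_eq_mul]; simp
    rw [MvPolynomial.X_mul_pderiv_monomial, h2, gmE_smul, h1, gmE_monomial m α hα,
      gmE_monomial m α hα, ← Finset.mul_prod_erase _ _ (Finset.mem_univ z),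
      ← Finset.mul_prod_erase _ _ (Finset.mem_univ z)]
    have h3 : ∏ j ∈ Finset.univ.erase z,
        (Real.Gamma (α j + ((Finsupp.single z 1 + s : Fin m →₀ ℕ) j : ℕ)) / Real.Gamma (α j))
        = ∏ j ∈ Finset.univ.erase z, (Real.Gamma (α j + s j) / Real.Gamma (α j)) := by
      refine Finset.prod_congr rfl (fun j hj => ?_)
      have : z ≠ j := (Finset.ne_of_mem_erase hj).symm
      simp [Finsupp.single_apply, this]
    have h4 : Real.Gamma (α z + ((Finsupp.single z 1 + s : Fin m →₀ ℕ) z : ℕ))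
        = (α z + s z) * Real.Gamma (α z + s z) := by
      have := hα z
      rw [← Real.Gamma_add_one (by positivity)]
      congr 1
      simp; ring
    rw [h3, h4]; ring
  | add p q hp hq =>
    simp only [map_add, mul_add, gmE_add m α hα, hp, hq]; ring

lemma gm_pderiv_prod {m : ℕ} {ι : Type*} [DecidableEq ι] (z : Fin m) (K : Finset ι)
    (f : ι → MvPolynomial (Fin m) ℝ) :
    MvPolynomial.pderiv z (∏ i ∈ K, f i)
      = ∑ i ∈ K, MvPolynomial.pderiv z (f i) * ∏ k ∈ K.erase i, f k := by
  induction K using Finset.induction_on with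
  | empty => simp
  | insert a s ha ih =>
    rw [Finset.prod_insert ha, Finset.sum_insert ha, Derivation.leibniz, ih,
      Finset.erase_insert ha, smul_eq_mul, smul_eq_mul, Finset.mul_sum, add_comm, mul_comm]
    congr 1
    refine Finset.sum_congr rfl (fun i hi => ?_)
    have hia : a ≠ i := fun h => ha (h ▸ hi)
    rw [Finset.erase_insert_of_ne hia, Finset.prod_insert (by simp [ha])]
    ring

lemma gm_comb {ι : Type*} [DecidableEq ι] (K : Finset ι) (F : Finset ι → ℝ) :
    ∑ J ∈ K.powerset, (J.card.factorial : ℝ) * F J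
      = F ∅ + ∑ i ∈ K, ∑ J ∈ (K.erase i).powerset, (J.card.factorial : ℝ) * F (insert i J) := by
  rw [← Finset.add_sum_erase _ _ (Finset.empty_mem_powerset K)]
  congr 1
  · simp
  have h1 : ∀ J ∈ K.powerset.erase ∅, (J.card.factorial : ℝ) * F J
      = ∑ i ∈ J, ((J.erase i).card.factorial : ℝ) * F J := by
    intro J hJ
    have hne : J.card ≠ 0 := by
      rw [Ne, Finset.card_eq_zero]; exact Finset.ne_of_mem_erase hJ
    have : ∀ i ∈ J, ((J.erase i).card.factorial : ℝ) * F J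
        = ((J.card - 1).factorial : ℝ) * F J := by
      intro i hi; rw [Finset.card_erase_of_mem hi]
    rw [Finset.sum_congr rfl this, Finset.sum_const, nsmul_eq_mul, ← mul_assoc,
      ← Nat.cast_mul, Nat.mul_factorial_pred hne]
  rw [Finset.sum_congr rfl h1, Finset.sum_sigma', Finset.sum_sigma']
  refine Finset.sum_bij' (fun x _ => ⟨x.2, x.1.erase x.2⟩) (fun y _ => ⟨insert y.1 y.2, y.1⟩)
    ?_ ?_ ?_ ?_ ?_
  · rintro ⟨J, i⟩ h
    simp only [Finset.mem_sigma, Finset.mem_erase, Finset.mem_powerset] at h ⊢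
    exact ⟨h.1.2 h.2, Finset.erase_subset_erase _ h.1.2⟩
  · rintro ⟨i, J⟩ h
    simp only [Finset.mem_sigma, Finset.mem_erase, Finset.mem_powerset] at h ⊢
    refine ⟨⟨Finset.insert_ne_empty _ _, ?_⟩, Finset.mem_insert_self _ _⟩
    exact Finset.insert_subset h.1 (h.2.trans (Finset.erase_subset _ _))
  · rintro ⟨J, i⟩ h
    simp only [Finset.mem_sigma] at h
    simp [Finset.insert_erase h.2]
  · rintro ⟨i, J⟩ h
    simp only [Finset.mem_sigma, Finset.mem_powerset] at h
    have : i ∉ J := fun hi => Finset.notMem_erase i K (h.2 hi)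
    simp [Finset.erase_insert this]
  · rintro ⟨J, i⟩ h
    simp only [Finset.mem_sigma] at h
    simp [Finset.insert_erase h.2]

noncomputable def gmL {n m : ℕ} (β : Fin n → Fin m → ℝ) (i : Fin n) : MvPolynomial (Fin m) ℝ :=
  ∑ j, MvPolynomial.C (β i j) * MvPolynomial.X j

lemma gmL_eval {n m : ℕ} (β : Fin n → Fin m → ℝ) (i : Fin n) (θ : Fin m → ℝ) :
    MvPolynomial.eval θ (gmL β i) = ∑ j, β i j * θ j := by
  simp [gmL]

lemma gmL_pderiv {n m : ℕ} (β : Fin n → Fin m → ℝ) (i : Fin n) (z : Fin m) :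
    MvPolynomial.pderiv z (gmL β i) = MvPolynomial.C (β i z) := by
  simp [gmL, MvPolynomial.pderiv_X, Pi.single_apply, Derivation.leibniz]

lemma gm_ptilde (n m : ℕ) (α : Fin m → ℝ) (β : Fin n → Fin m → ℝ) (K : Finset (Fin n)) :
    ptilde n m α β K = gmE m α (∏ i ∈ K, gmL β i) := by
  simp only [ptilde, gmE, map_prod, gmL_eval]

lemma gm_main (n m : ℕ) (α : Fin m → ℝ) (hα : ∀ j, 0 < α j) (β : Fin n → Fin m → ℝ)
    (z : Fin m) (K : Finset (Fin n)) :
    gmE m α (MvPolynomial.X z * ∏ i ∈ K, gmL β i)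
      = α z * ∑ J ∈ K.powerset, (J.card.factorial : ℝ) *
          ((∏ i ∈ J, β i z) * ptilde n m α β (K \ J)) := by
  induction K using Finset.strongInduction with
  | H K ih =>
    rw [gmE_stein m α hα, gm_pderiv_prod, Finset.mul_sum, gmE_sum m α hα,
      gm_comb K (fun J => (∏ i ∈ J, β i z) * ptilde n m α β (K \ J)), mul_add, gm_ptilde]
    congr 1
    · simp
    rw [Finset.mul_sum]
    refine Finset.sum_congr rfl (fun i hi => ?_)
    rw [gmL_pderiv, mul_left_comm, gmE_smul, ih _ (Finset.erase_ssubset hi), mul_left_comm,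
      Finset.mul_sum]
    congr 1
    refine Finset.sum_congr rfl (fun J hJ => ?_)
    have hiJ : i ∉ J := fun h => Finset.notMem_erase i K (Finset.mem_powerset.1 hJ h)
    have : K.erase i \ J = K \ insert i J := by
      ext x; simp only [Finset.mem_sdiff, Finset.mem_erase, Finset.mem_insert]; tauto
    rw [Finset.prod_insert hiJ, this]; ring

theorem gamma_expectation_theta_mul (n m : ℕ) (hn : 1 ≤ n) (hm : 1 ≤ m)
    (α : Fin m → ℝ) (hα : ∀ j, 0 < α j) (β : Fin n → Fin m → ℝ) (z : Fin m) :
    (∫ θ : Fin m → ℝ in {θ | ∀ j, 0 < θ j},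
        (∏ j, θ j ^ (α j - 1) * Real.exp (-θ j) / Real.Gamma (α j)) *
          (θ z * ∏ i, (∑ j, β i j * θ j)))
      = α z * ∑ J : Finset (Fin n),
          (∏ i ∈ J, β i z) * (J.card.factorial : ℝ) *
            ptilde n m α β (Finset.univ \ J) := by
  have h := gm_main n m α hα β z Finset.univ
  rw [Finset.powerset_univ] at h
  simp only [gmE, map_mul, map_prod, gmL_eval, MvPolynomial.eval_X] at h
  rw [h]
  congr 1
  refine Finset.sum_congr rfl (fun J _ => ?_)
  ring
end

section
/- Assume α j > 0 for all j, β i j ≥ 0 for all i, j, and p̃(Fin n) > 0. Then for every z ∈ Fin m, the posterior mean satisfies E[θ_z | w] = (α_z / (n + |α|)) · ∑_{J ⊆ Fin n} (∏_{i∈J} β i z) · |J|! · p̃(Fin n ∖ J) / p̃(Fin n). -/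
open MeasureTheory Real Finset

lemma beta_lint {a b s : ℝ} (ha : 0 < a) (hb : 0 < b) (hs : 0 < s) :
    ∫⁻ x in Set.Ioo 0 s, ENNReal.ofReal (x ^ (a - 1) * (s - x) ^ (b - 1))
      = ENNReal.ofReal (s ^ (a + b - 1) * (Gamma a * Gamma b / Gamma (a + b))) := by
  have h1 := Complex.betaIntegral_scaled a b hs
  rw [Complex.betaIntegral_eq_Gamma_mul_div _ _ (by simpa) (by simpa),
    intervalIntegral.integral_of_le hs.le, integral_Ioc_eq_integral_Ioo] at h1
  have h2 : ∫ x in Set.Ioo 0 s, (x:ℂ) ^ ((a:ℂ) - 1) * ((s:ℂ) - x) ^ ((b:ℂ) - 1)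
      = ∫ x in Set.Ioo 0 s, ((x ^ (a - 1) * (s - x) ^ (b - 1) : ℝ) : ℂ) := by
    refine setIntegral_congr_fun measurableSet_Ioo fun x hx => ?_
    rw [Complex.ofReal_mul, Complex.ofReal_cpow hx.1.le, Complex.ofReal_cpow (by linarith [hx.2])]
    push_cast
    rfl
  rw [h2, integral_complex_ofReal] at h1
  have h3 : ∫ x in Set.Ioo 0 s, x ^ (a - 1) * (s - x) ^ (b - 1)
      = s ^ (a + b - 1) * (Gamma a * Gamma b / Gamma (a + b)) := by
    apply Complex.ofReal_injective
    refine h1.trans ?_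
    rw [← Complex.ofReal_add, Complex.Gamma_ofReal, Complex.Gamma_ofReal, Complex.Gamma_ofReal]
    rw [Complex.ofReal_mul, Complex.ofReal_cpow hs.le]
    push_cast
    rfl
  have hpos : 0 < s ^ (a + b - 1) * (Gamma a * Gamma b / Gamma (a + b)) := by
    have := Gamma_pos_of_pos ha
    have := Gamma_pos_of_pos hb
    have := Gamma_pos_of_pos (add_pos ha hb)
    positivity
  have hint : IntegrableOn (fun x => x ^ (a - 1) * (s - x) ^ (b - 1)) (Set.Ioo 0 s) := by
    by_contra h
    rw [integral_undef h] at h3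
    exact hpos.ne h3
  rw [← h3, ofReal_integral_eq_lintegral_ofReal hint]
  refine ae_restrict_of_forall_mem measurableSet_Ioo fun x hx => ?_
  have := hx.1
  have : 0 < s - x := by linarith [hx.2]
  simp only [Pi.zero_apply]
  positivity

def SS (k : ℕ) (s : ℝ) : Set (Fin k → ℝ) := {x | (∀ j, 0 ≤ x j) ∧ ∑ j, x j ≤ s}

lemma SS_meas (k : ℕ) (s : ℝ) : MeasurableSet (SS k s) := by
  have : SS k s = (⋂ j, {x : Fin k → ℝ | 0 ≤ x j}) ∩ {x | ∑ j, x j ≤ s} := by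
    ext x; simp [SS]
  rw [this]
  refine MeasurableSet.inter (MeasurableSet.iInter fun j => ?_) ?_
  · exact measurableSet_le measurable_const (measurable_pi_apply j)
  · exact measurableSet_le (by fun_prop) measurable_const

noncomputable def FF (k : ℕ) (a : Fin k → ℝ) (b s : ℝ) (x : Fin k → ℝ) : ℝ :=
  (∏ j, x j ^ (a j - 1)) * (s - ∑ j, x j) ^ (b - 1)

lemma FF_meas (k : ℕ) (a : Fin k → ℝ) (b s : ℝ) : Measurable (FF k a b s) := by
  unfold FF; fun_prop

lemma dir_lint (k : ℕ) : ∀ (a : Fin k → ℝ) (_ : ∀ j, 0 < a j) (b : ℝ) (_ : 0 < b) (s : ℝ)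
    (_ : 0 < s),
    ∫⁻ x, (SS k s).indicator (fun x => ENNReal.ofReal (FF k a b s x)) x
      = ENNReal.ofReal (s ^ (∑ j, a j + b - 1) *
          ((∏ j, Gamma (a j)) * Gamma b / Gamma (∑ j, a j + b))) := by
  induction k with
  | zero =>
    intro a ha b hb s hs
    have : Gamma b ≠ 0 := (Gamma_pos_of_pos hb).ne'
    rw [lintegral_unique]
    simp [SS, FF, hs.le, this, volume_pi]
  | succ k ih =>
    intro a ha b hb s hs
    have hmp := (volume_preserving_piFinSuccAbove (fun _ : Fin (k+1) => ℝ) 0).symm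
    rw [← hmp.lintegral_comp (((FF_meas _ _ _ _).ennreal_ofReal).indicator (SS_meas _ _))]
    have hmeas : Measurable fun q : ℝ × (Fin k → ℝ) =>
        (SS (k+1) s).indicator (fun x => ENNReal.ofReal (FF (k+1) a b s x))
          ((MeasurableEquiv.piFinSuccAbove (fun _ : Fin (k+1) => ℝ) 0).symm q) :=
      (((FF_meas _ _ _ _).ennreal_ofReal).indicator (SS_meas _ _)).comp hmp.measurable
    rw [Measure.volume_eq_prod, lintegral_prod _ hmeas.aemeasurable]
    have key : ∀ t y, (SS (k+1) s).indicator (fun x => ENNReal.ofReal (FF (k+1) a b s x))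
        ((MeasurableEquiv.piFinSuccAbove (fun _ : Fin (k+1) => ℝ) 0).symm (t, y))
        = if 0 ≤ t then ENNReal.ofReal (t ^ (a 0 - 1)) *
          (SS k (s - t)).indicator
            (fun x => ENNReal.ofReal (FF k (fun j => a j.succ) b (s - t) x)) y else 0 := by
      intro t y
      have hc : (MeasurableEquiv.piFinSuccAbove (fun _ : Fin (k+1) => ℝ) 0).symm (t, y)
        = Fin.cons t y := by
        ext j; simp [MeasurableEquiv.piFinSuccAbove, Fin.insertNthEquiv]
      rw [hc]
      by_cases ht : 0 ≤ t
      · rw [if_pos ht]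
        have hiff : (Fin.cons t y : Fin (k+1) → ℝ) ∈ SS (k+1) s ↔ y ∈ SS k (s - t) := by
          simp [SS, Fin.forall_fin_succ, Fin.sum_univ_succ, ht, le_sub_iff_add_le']
        by_cases hy : y ∈ SS k (s - t)
        · rw [Set.indicator_of_mem (hiff.2 hy), Set.indicator_of_mem hy,
            ← ENNReal.ofReal_mul (by positivity)]
          congr 1
          simp only [FF, Fin.prod_univ_succ, Fin.sum_univ_succ, Fin.cons_zero, Fin.cons_succ]
          rw [mul_assoc, sub_sub]
        · rw [Set.indicator_of_notMem (fun h => hy (hiff.1 h)), Set.indicator_of_notMem hy, mul_zero]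
      · rw [if_neg ht, Set.indicator_of_notMem]
        intro h
        exact ht (by simpa using h.1 0)
    have hA : 0 < ∑ j : Fin k, a j.succ + b :=
      add_pos_of_nonneg_of_pos (Finset.sum_nonneg fun j _ => (ha _).le) hb
    set A := ∑ j : Fin k, a j.succ + b with hAdef
    set C := (∏ j : Fin k, Gamma (a j.succ)) * Gamma b / Gamma A with hC
    have hCpos : 0 < C := by
      have := Gamma_pos_of_pos hb
      have := Gamma_pos_of_pos hA
      have : 0 < ∏ j : Fin k, Gamma (a j.succ) :=
        Finset.prod_pos fun j _ => Gamma_pos_of_pos (ha _)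
      positivity
    have inner : ∀ᵐ t : ℝ, ∫⁻ y, (SS (k+1) s).indicator
        (fun x => ENNReal.ofReal (FF (k+1) a b s x))
        ((MeasurableEquiv.piFinSuccAbove (fun _ : Fin (k+1) => ℝ) 0).symm (t, y))
        = (Set.Ioo 0 s).indicator
          (fun t => ENNReal.ofReal C * ENNReal.ofReal (t ^ (a 0 - 1) * (s - t) ^ (A - 1))) t := by
      filter_upwards [Measure.ae_ne volume (0:ℝ), Measure.ae_ne volume s] with t ht0 hts
      simp_rw [key]
      by_cases ht : 0 ≤ t
      · simp only [if_pos ht]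
        by_cases hlt : t < s
        · have hmem : t ∈ Set.Ioo 0 s := ⟨lt_of_le_of_ne ht (Ne.symm ht0), hlt⟩
          rw [Set.indicator_of_mem hmem,
            lintegral_const_mul _ (((FF_meas _ _ _ _).ennreal_ofReal).indicator (SS_meas _ _)),
            ih _ (fun j => ha _) b hb _ (sub_pos.2 hlt), ← ENNReal.ofReal_mul (by positivity),
            ← ENNReal.ofReal_mul hCpos.le]
          congr 1
          ring
        · rw [Set.indicator_of_notMem (fun h => hlt h.2)]
          have hgt : s < t := lt_of_le_of_ne (not_lt.1 hlt) (Ne.symm hts)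
          have : SS k (s - t) = ∅ := by
            ext y
            simp only [SS, Set.mem_ofPred_eq, Set.mem_empty_iff_false, iff_false]
            rintro ⟨h1, h2⟩
            have := Finset.sum_nonneg (s := Finset.univ) fun j _ => h1 j
            linarith
          simp [this]
      · rw [Set.indicator_of_notMem (fun h => ht h.1.le)]
        simp [ht]
    rw [lintegral_congr_ae inner, lintegral_indicator measurableSet_Ioo,
      lintegral_const_mul _ (by fun_prop), beta_lint (ha 0) hA hs, ← ENNReal.ofReal_mul hCpos.le]
    congr 1
    rw [Fin.sum_univ_succ, Fin.prod_univ_succ, add_assoc, ← hAdef, hC]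
    have := (Gamma_pos_of_pos hA).ne'
    field_simp

lemma FF_nonneg {k : ℕ} {a : Fin k → ℝ} {b s : ℝ} {x : Fin k → ℝ} (hx : x ∈ SS k s) :
    0 ≤ FF k a b s x := by
  have : 0 ≤ s - ∑ j, x j := sub_nonneg.2 hx.2
  exact mul_nonneg (Finset.prod_nonneg fun j _ => rpow_nonneg (hx.1 j) _) (rpow_nonneg this _)

lemma dir_int (k : ℕ) (a : Fin (k+1) → ℝ) (ha : ∀ j, 0 < a j) :
    IntegrableOn (fun x => ∏ j, (coordMap (k+1) x) j ^ (a j - 1)) (simplexDom (k+1)) ∧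
    ∫ x in simplexDom (k+1), ∏ j, (coordMap (k+1) x) j ^ (a j - 1)
      = (∏ j, Gamma (a j)) / Gamma (∑ j, a j) := by
  have hF : (fun x => ∏ j, (coordMap (k+1) x) j ^ (a j - 1))
      = FF k (fun j => a j.castSucc) (a (Fin.last k)) 1 := by
    ext x
    rw [Fin.prod_univ_castSucc]
    simp [FF, coordMap]
  have hS : simplexDom (k+1) = SS k 1 := rfl
  have h := dir_lint k (fun j => a j.castSucc) (fun j => ha _) (a (Fin.last k)) (ha _) 1 one_pos
  rw [lintegral_indicator (SS_meas _ _)] at h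
  rw [one_rpow, one_mul, ← Fin.sum_univ_castSucc (f := a),
    ← Fin.prod_univ_castSucc (f := fun j => Gamma (a j))] at h
  have hnn : ∀ᵐ x ∂(volume.restrict (SS k 1)),
      0 ≤ FF k (fun j => a j.castSucc) (a (Fin.last k)) 1 x :=
    ae_restrict_of_forall_mem (SS_meas _ _) fun x hx => FF_nonneg hx
  have hv : 0 ≤ (∏ j, Gamma (a j)) / Gamma (∑ j, a j) :=
    div_nonneg (Finset.prod_nonneg fun j _ => (Gamma_pos_of_pos (ha j)).le)
      (Gamma_nonneg_of_nonneg (Finset.sum_nonneg fun j _ => (ha j).le))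
  rw [hS, hF]
  constructor
  · refine ⟨(FF_meas _ _ _ _).aestronglyMeasurable, ?_⟩
    rw [hasFiniteIntegral_iff_ofReal hnn, h]
    exact ENNReal.ofReal_lt_top
  · rw [integral_eq_lintegral_of_nonneg_ae hnn (FF_meas _ _ _ _).aestronglyMeasurable, h,
      ENNReal.toReal_ofReal hv]

noncomputable def WW {m : ℕ} (α : Fin m → ℝ) (a : Fin m →₀ ℕ) : ℝ :=
  ∏ j, Gamma (α j + a j) / Gamma (α j)

noncomputable def Phi {m : ℕ} (α : Fin m → ℝ) : MvPolynomial (Fin m) ℝ →ₗ[ℝ] ℝ :=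
  (MvPolynomial.basisMonomials (Fin m) ℝ).constr ℝ (WW α)

lemma Phi_monomial {m : ℕ} (α : Fin m → ℝ) (a : Fin m →₀ ℕ) (c : ℝ) :
    Phi α (MvPolynomial.monomial a c) = c * WW α a := by
  have h : MvPolynomial.monomial a c = c • MvPolynomial.basisMonomials (Fin m) ℝ a := by
    simp [MvPolynomial.smul_monomial]
  rw [h, map_smul, Phi, Module.Basis.constr_basis, smul_eq_mul]

lemma Phi_eq {m : ℕ} (α : Fin m → ℝ) (p : MvPolynomial (Fin m) ℝ) :
    Phi α p = ∑ a ∈ p.support, p.coeff a * WW α a := by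
  conv_lhs => rw [p.as_sum]
  rw [map_sum]
  exact Finset.sum_congr rfl fun a _ => Phi_monomial _ _ _

lemma int_poly {X : Type*} [MeasurableSpace X] (μ : Measure X) {m : ℕ} (T : X → Fin m → ℝ)
    (w : X → ℝ) (I : (Fin m →₀ ℕ) → ℝ) (p : MvPolynomial (Fin m) ℝ)
    (h1 : ∀ a ∈ p.support, Integrable (fun x => (∏ j, T x j ^ a j) * w x) μ)
    (h2 : ∀ a ∈ p.support, ∫ x, (∏ j, T x j ^ a j) * w x ∂μ = I a) :
    ∫ x, MvPolynomial.eval (T x) p * w x ∂μ = ∑ a ∈ p.support, p.coeff a * I a := by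
  simp_rw [MvPolynomial.eval_eq', Finset.sum_mul, mul_assoc]
  rw [integral_finsetSum _ fun a ha => (h1 a ha).const_mul _]
  refine Finset.sum_congr rfl fun a ha => ?_
  rw [integral_const_mul, h2 a ha]

lemma gam1 {a : ℝ} (ha : 0 < a) (k : ℕ) :
    IntegrableOn (fun t : ℝ => t ^ k * (t ^ (a - 1) * exp (-t) / Gamma a)) (Set.Ioi 0) ∧
    ∫ t in Set.Ioi (0:ℝ), t ^ k * (t ^ (a - 1) * exp (-t) / Gamma a)
      = Gamma (a + k) / Gamma a := by
  have hk : 0 < a + k := by positivity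
  have he : Set.EqOn (fun t : ℝ => exp (-t) * t ^ (a + k - 1) / Gamma a)
      (fun t : ℝ => t ^ k * (t ^ (a - 1) * exp (-t) / Gamma a)) (Set.Ioi 0) := by
    intro t ht
    have ht' : (0:ℝ) < t := ht
    have : t ^ (a + k - 1) = t ^ (a - 1) * t ^ k := by
      rw [← rpow_add_natCast ht'.ne']; congr 1; ring
    simp only [this]; ring
  constructor
  · exact IntegrableOn.congr_fun (Integrable.div_const (GammaIntegral_convergent hk) _) he measurableSet_Ioi
  · rw [← setIntegral_congr_fun measurableSet_Ioi he, integral_div, ← Gamma_eq_integral hk]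

lemma gam_int {m : ℕ} (α : Fin m → ℝ) (hα : ∀ j, 0 < α j) (p : MvPolynomial (Fin m) ℝ) :
    ∫ θ : Fin m → ℝ in {θ | ∀ j, 0 < θ j},
      MvPolynomial.eval θ p * (∏ j, θ j ^ (α j - 1) * Real.exp (-θ j) / Real.Gamma (α j))
      = Phi α p := by
  have hset : {θ : Fin m → ℝ | ∀ j, 0 < θ j} = Set.univ.pi fun _ => Set.Ioi 0 := by
    ext; simp
  rw [Phi_eq, hset, volume_pi, Measure.restrict_pi_pi]
  refine int_poly _ (fun θ => θ) _ _ p (fun a _ => ?_) (fun a _ => ?_)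
  · simp_rw [← Finset.prod_mul_distrib]
    exact Integrable.fintype_prod (f := fun j (t : ℝ) =>
      t ^ a j * (t ^ (α j - 1) * exp (-t) / Gamma (α j))) fun j => (gam1 (hα j) (a j)).1
  · simp_rw [← Finset.prod_mul_distrib]
    rw [integral_fintype_prod_eq_prod (fun j (t : ℝ) =>
      t ^ a j * (t ^ (α j - 1) * exp (-t) / Gamma (α j)))]
    exact Finset.prod_congr rfl fun j _ => (gam1 (hα j) (a j)).2

lemma dirExp_hom {m : ℕ} (hm : 1 ≤ m) (α : Fin m → ℝ) (hα : ∀ j, 0 < α j)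
    (p : MvPolynomial (Fin m) ℝ) (d : ℕ) (hp : p.IsHomogeneous d) :
    dirExp m α (fun θ => MvPolynomial.eval θ p)
      = Gamma (∑ j, α j) / Gamma (∑ j, α j + d) * Phi α p := by
  obtain ⟨k, rfl⟩ : ∃ k, m = k + 1 := ⟨m - 1, by omega⟩
  have hSm : MeasurableSet (simplexDom (k+1)) := SS_meas k 1
  have hΓ : ∀ j, Gamma (α j) ≠ 0 := fun j => (Gamma_pos_of_pos (hα j)).ne'
  have hnn : ∀ x ∈ simplexDom (k+1), ∀ j, 0 ≤ coordMap (k+1) x j := by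
    intro x hx j
    unfold coordMap
    split_ifs
    · exact hx.1 _
    · exact sub_nonneg.2 hx.2
  have hpos : ∀ (a : Fin (k+1) →₀ ℕ) j, 0 < α j + a j := fun a j => by
    have := hα j; positivity
  have he : ∀ a : Fin (k+1) →₀ ℕ, Set.EqOn
      (fun x => ∏ j, coordMap (k+1) x j ^ (α j + a j - 1))
      (fun x => (∏ j, coordMap (k+1) x j ^ a j) * ∏ j, coordMap (k+1) x j ^ (α j - 1))
      (simplexDom (k+1)) := by
    intro a x hx
    simp only [← Finset.prod_mul_distrib]
    refine Finset.prod_congr rfl fun j _ => ?_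
    rcases Nat.eq_zero_or_pos (a j) with h | h
    · simp [h]
    · have h1 : (1:ℝ) ≤ a j := by exact_mod_cast h
      have h2 := hα j
      rw [mul_comm, ← rpow_add_natCast' (hnn x hx j) (by linarith)]
      congr 1; ring
  unfold dirExp
  rw [integral_div]
  rw [int_poly _ (coordMap (k+1)) (fun x => ∏ j, coordMap (k+1) x j ^ (α j - 1))
    (fun a => (∏ j, Gamma (α j + a j)) / Gamma (∑ j, (α j + a j))) p
    (fun a _ => ((dir_int k _ (hpos a)).1).congr_fun (he a) hSm)
    (fun a _ => by rw [← (dir_int k _ (hpos a)).2]; exact (setIntegral_congr_fun hSm (he a)).symm)]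
  rw [Phi_eq, Finset.mul_sum, Finset.sum_div]
  refine Finset.sum_congr rfl fun a ha => ?_
  have hd : ∑ j, (a j : ℝ) = d := by
    have := hp (MvPolynomial.mem_support_iff.1 ha)
    rw [Finsupp.weight_apply, Finsupp.sum_fintype _ _ (by simp)] at this
    simp at this
    exact_mod_cast this
  rw [Finset.sum_add_distrib, hd, WW, Finset.prod_div_distrib]
  have h3 : ∏ j, Gamma (α j) ≠ 0 := Finset.prod_ne_zero_iff.2 fun j _ => hΓ j
  field_simp

lemma stein {m : ℕ} (α : Fin m → ℝ) (hα : ∀ j, 0 < α j) (z : Fin m)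
    (p : MvPolynomial (Fin m) ℝ) :
    Phi α (MvPolynomial.X z * p) = α z * Phi α p
      + Phi α (MvPolynomial.X z * MvPolynomial.pderiv z p) := by
  induction p using MvPolynomial.induction_on' with
  | add p q hp hq => simp only [mul_add, map_add, hp, hq]; ring
  | monomial a c =>
    have hX : MvPolynomial.X z * MvPolynomial.monomial a c
        = MvPolynomial.monomial (a + Finsupp.single z 1) c := by
      rw [mul_comm, MvPolynomial.monomial_add_single, pow_one]
    have hP : MvPolynomial.X z * MvPolynomial.pderiv z (MvPolynomial.monomial a c)
        = MvPolynomial.monomial a (c * a z) := by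
      rw [MvPolynomial.X_mul_pderiv_monomial, ← Nat.cast_smul_eq_nsmul ℝ, MvPolynomial.smul_monomial,
        smul_eq_mul, mul_comm]
    rw [hX, hP, Phi_monomial, Phi_monomial, Phi_monomial]
    have hW : WW α (a + Finsupp.single z 1) = (α z + a z) * WW α a := by
      unfold WW
      rw [← Finset.mul_prod_erase _ _ (Finset.mem_univ z),
        ← Finset.mul_prod_erase _ (fun j => Gamma (α j + a j) / Gamma (α j)) (Finset.mem_univ z)]
      have h1 : ∏ j ∈ Finset.univ.erase z,
          Gamma (α j + ((a + Finsupp.single z 1 : Fin m →₀ ℕ) j : ℕ)) / Gamma (α j)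
          = ∏ j ∈ Finset.univ.erase z, Gamma (α j + a j) / Gamma (α j) := by
        refine Finset.prod_congr rfl fun j hj => ?_
        have : j ≠ z := (Finset.mem_erase.1 hj).1
        simp [Finsupp.single_apply, this.symm]
      have hz : α z + a z ≠ 0 := by have := hα z; positivity
      rw [h1]
      have h2 : α z + ((a + Finsupp.single z 1 : Fin m →₀ ℕ) z : ℕ) = (α z + a z) + 1 := by
        simp; ring
      rw [h2, Gamma_add_one hz]
      ring
    rw [hW]; ring

noncomputable def LL {n m : ℕ} (β : Fin n → Fin m → ℝ) (i : Fin n) : MvPolynomial (Fin m) ℝ :=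
  ∑ j, MvPolynomial.C (β i j) * MvPolynomial.X j

noncomputable def PP {n m : ℕ} (β : Fin n → Fin m → ℝ) (K : Finset (Fin n)) :
    MvPolynomial (Fin m) ℝ := ∏ i ∈ K, LL β i

lemma eval_PP {n m : ℕ} (β : Fin n → Fin m → ℝ) (K : Finset (Fin n)) (θ : Fin m → ℝ) :
    MvPolynomial.eval θ (PP β K) = ∏ i ∈ K, ∑ j, β i j * θ j := by
  simp [PP, LL, map_prod]

lemma hom_PP {n m : ℕ} (β : Fin n → Fin m → ℝ) (K : Finset (Fin n)) :
    (PP β K).IsHomogeneous K.card := by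
  have := MvPolynomial.IsHomogeneous.prod K (LL β) (fun _ => 1) fun i _ =>
    MvPolynomial.IsHomogeneous.sum _ _ 1 fun j _ => by
      simpa using (MvPolynomial.isHomogeneous_X ℝ j).C_mul (β i j)
  simpa [PP] using this

lemma pderiv_LL {n m : ℕ} (β : Fin n → Fin m → ℝ) (i : Fin n) (z : Fin m) :
    MvPolynomial.pderiv z (LL β i) = MvPolynomial.C (β i z) := by
  classical
  simp [LL, MvPolynomial.pderiv_X, Pi.single_apply]

lemma pderiv_PP {n m : ℕ} (β : Fin n → Fin m → ℝ) (z : Fin m) (K : Finset (Fin n)) :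
    MvPolynomial.pderiv z (PP β K) = ∑ i ∈ K, MvPolynomial.C (β i z) * PP β (K.erase i) := by
  induction K using Finset.induction_on with
  | empty => simp [PP]
  | insert i K hi ih =>
    have h0 : PP β (insert i K) = LL β i * PP β K := Finset.prod_insert hi
    rw [h0, Derivation.leibniz, ih, Finset.sum_insert hi, Finset.erase_insert hi, pderiv_LL,
      smul_eq_mul, smul_eq_mul, Finset.mul_sum, add_comm]
    congr 1
    · ring
    · refine Finset.sum_congr rfl fun j hj => ?_
      have hij : i ≠ j := fun h => hi (h ▸ hj)
      have : PP β ((insert i K).erase j) = LL β i * PP β (K.erase j) := by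
        rw [Finset.erase_insert_of_ne hij]
        exact Finset.prod_insert fun h => hi (Finset.mem_of_mem_erase h)
      rw [this]; ring

lemma ptilde_eq {n m : ℕ} (α : Fin m → ℝ) (hα : ∀ j, 0 < α j) (β : Fin n → Fin m → ℝ)
    (K : Finset (Fin n)) : ptilde n m α β K = Phi α (PP β K) := by
  rw [← gam_int α hα]
  unfold ptilde
  simp_rw [eval_PP, mul_comm]

lemma main_rec {n m : ℕ} (α : Fin m → ℝ) (hα : ∀ j, 0 < α j) (β : Fin n → Fin m → ℝ)
    (z : Fin m) (K : Finset (Fin n)) :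
    Phi α (MvPolynomial.X z * PP β K) = α z * ∑ J ∈ K.powerset,
      (∏ i ∈ J, β i z) * (J.card.factorial : ℝ) * Phi α (PP β (K \ J)) := by
  induction K using Finset.strongInduction with
  | H K ih =>
    rw [stein α hα, pderiv_PP, Finset.mul_sum, map_sum]
    have h1 : ∀ i ∈ K, Phi α (MvPolynomial.X z * (MvPolynomial.C (β i z) * PP β (K.erase i)))
        = α z * ∑ J ∈ K.powerset with i ∈ J,
          (∏ i ∈ J, β i z) * ((J.card - 1).factorial : ℝ) * Phi α (PP β (K \ J)) := by
      intro i hi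
      have : MvPolynomial.X z * (MvPolynomial.C (β i z) * PP β (K.erase i))
        = β i z • (MvPolynomial.X z * PP β (K.erase i)) := by
        rw [MvPolynomial.smul_eq_C_mul]; ring
      rw [this, map_smul, ih _ (Finset.erase_ssubset hi), smul_eq_mul, mul_left_comm,
        Finset.mul_sum]
      congr 1
      refine Finset.sum_bij' (fun J _ => insert i J) (fun J _ => J.erase i) ?_ ?_ ?_ ?_ ?_
      · intro J hJ
        rw [Finset.mem_powerset] at hJ
        simp only [Finset.mem_filter, Finset.mem_powerset]
        exact ⟨Finset.insert_subset hi (hJ.trans (Finset.erase_subset _ _)),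
          Finset.mem_insert_self _ _⟩
      · intro J hJ
        simp only [Finset.mem_filter, Finset.mem_powerset] at hJ
        exact Finset.mem_powerset.2 (Finset.erase_subset_erase _ hJ.1)
      · intro J hJ
        rw [Finset.mem_powerset] at hJ
        exact Finset.erase_insert fun h => (Finset.mem_erase.1 (hJ h)).1 rfl
      · intro J hJ
        simp only [Finset.mem_filter, Finset.mem_powerset] at hJ
        exact Finset.insert_erase hJ.2
      · intro J hJ
        rw [Finset.mem_powerset] at hJ
        have hiJ : i ∉ J := fun h => (Finset.mem_erase.1 (hJ h)).1 rfl
        have : K.erase i \ J = K \ insert i J := by ext x; simp; tauto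
        rw [Finset.prod_insert hiJ, Finset.card_insert_of_notMem hiJ, this]
        simp only [Nat.add_sub_cancel]
        ring
    rw [Finset.sum_congr rfl h1, ← Finset.mul_sum, ← mul_add]
    congr 1
    simp_rw [Finset.sum_filter]
    rw [Finset.sum_comm]
    have h2 : Phi α (PP β K) = ∑ J ∈ K.powerset, if J = ∅ then Phi α (PP β K) else 0 := by
      simp
    rw [h2, ← Finset.sum_add_distrib]
    refine Finset.sum_congr rfl fun J hJ => ?_
    rw [Finset.mem_powerset] at hJ
    rw [← Finset.sum_filter, Finset.filter_mem_eq_inter, Finset.inter_eq_right.2 hJ,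
      Finset.sum_const]
    by_cases h : J = ∅
    · subst h; simp
    · have hc : J.card ≠ 0 := by simpa using h
      rw [if_neg h, zero_add, nsmul_eq_mul, ← Nat.mul_factorial_pred hc]
      push_cast
      ring

theorem posterior_mean_formula (n m : ℕ) (hn : 1 ≤ n) (hm : 1 ≤ m)
    (α : Fin m → ℝ) (hα : ∀ j, 0 < α j)
    (β : Fin n → Fin m → ℝ) (hβ : ∀ i j, 0 ≤ β i j)
    (hp : 0 < ptilde n m α β Finset.univ) (z : Fin m) :
    dirExp m α (fun θ => θ z * ∏ i : Fin n, ∑ j, β i j * θ j) /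
        dirExp m α (fun θ => ∏ i : Fin n, ∑ j, β i j * θ j)
      = α z / (n + ∑ j, α j) *
          ∑ J : Finset (Fin n),
            (∏ i ∈ J, β i z) * (J.card.factorial : ℝ) *
              (ptilde n m α β (Finset.univ \ J) / ptilde n m α β Finset.univ) := by
  have h1 : dirExp m α (fun θ => θ z * ∏ i : Fin n, ∑ j, β i j * θ j)
      = Gamma (∑ j, α j) / Gamma (∑ j, α j + (n + 1 : ℕ)) *
        Phi α (MvPolynomial.X z * PP β Finset.univ) := by
    rw [← dirExp_hom hm α hα _ (n + 1)]
    · simp only [map_mul, MvPolynomial.eval_X, eval_PP]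
    · have := (MvPolynomial.isHomogeneous_X ℝ z).mul (hom_PP β Finset.univ)
      simpa [add_comm] using this
  have h2 : dirExp m α (fun θ => ∏ i : Fin n, ∑ j, β i j * θ j)
      = Gamma (∑ j, α j) / Gamma (∑ j, α j + n) * Phi α (PP β Finset.univ) := by
    rw [← dirExp_hom hm α hα _ n]
    · simp only [eval_PP]
    · simpa using hom_PP β Finset.univ
  have hS : 0 < ∑ j, α j :=
    Finset.sum_pos (fun j _ => hα j) ⟨z, Finset.mem_univ z⟩
  rw [h1, h2, main_rec α hα, Finset.powerset_univ]
  rw [ptilde_eq α hα] at hp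
  simp_rw [ptilde_eq α hα, ← mul_div_assoc]
  rw [← Finset.sum_div]
  have hA : 0 < ∑ j, α j + (n : ℝ) := by positivity
  have hG : Gamma (∑ j, α j + (n + 1 : ℕ)) = (∑ j, α j + n) * Gamma (∑ j, α j + n) := by
    rw [← Gamma_add_one hA.ne']
    push_cast
    rw [add_assoc]
  rw [hG, add_comm (n : ℝ)]
  have g1 := (Gamma_pos_of_pos hS).ne'
  have g2 := (Gamma_pos_of_pos hA).ne'
  have g3 := hp.ne'
  have g4 := hA.ne'
  field_simp
end

section
/- Assume α j > 0 for all j and p̃(Fin n) ≠ 0. Then for every z ∈ Fin m, E_{Dir(α)}[θ_z · ∏_{i=1}^n ∑_j β i j θ_j] / E_{Dir(α)}[∏_{i=1}^n ∑_j β i j θ_j] = (1 / (|α| + n)) · (∫_{(0,∞)^m} (∏_j θ_j^{α_j−1} e^{−θ_j}/Γ(α_j)) · θ_z · ∏_{i=1}^n (∑_j β i j θ_j) dθ) / p̃(Fin n); that is, the posterior mean of θ_z equals 1/(n+|α|) times the ratio of the corresponding Gamma-product expectations. -/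
open MeasureTheory Real Finset

lemma aux_mp (k : ℕ) : MeasurePreserving
    (fun p : (Fin k → ℝ) × ℝ => (Fin.last k).insertNth (α := fun _ => ℝ) (p.2 - ∑ j, p.1 j) p.1)
    (volume.prod volume) volume := by
  have h1 : MeasurePreserving (fun p : (Fin k → ℝ) × ℝ => (p.1, p.2 - ∑ j, p.1 j))
      ((volume : Measure (Fin k → ℝ)).prod (volume : Measure ℝ)) (volume.prod volume) := by
    refine MeasurePreserving.skew_product (g := fun (y : Fin k → ℝ) (s : ℝ) => s - ∑ j, y j)
      (MeasurePreserving.id _) (by fun_prop) ?_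
    refine Filter.Eventually.of_forall fun y => ?_
    exact (measurePreserving_sub_right volume (∑ j, y j)).map_eq
  have h2 : MeasurePreserving Prod.swap
      ((volume : Measure (Fin k → ℝ)).prod (volume : Measure ℝ)) (volume.prod volume) :=
    Measure.measurePreserving_swap
  have h3 := (volume_preserving_piFinSuccAbove (fun _ : Fin (k+1) => ℝ) (Fin.last k)).symm
  exact (h3.comp h2).comp h1

lemma aux_coord (k : ℕ) (x : Fin k → ℝ) (s : ℝ) :
    (Fin.last k).insertNth (α := fun _ => ℝ) (s - ∑ j, (s • x) j) (s • x) =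
      s • coordMap (k+1) x := by
  funext j
  refine Fin.lastCases ?_ (fun i => ?_) j
  · simp [coordMap, mul_sub, Finset.mul_sum]
  · have : (i : ℕ) < k := i.2
    simp [coordMap]

lemma aux_integrable (m : ℕ) (α : Fin m → ℝ) (hα : ∀ j, 0 < α j)
    (g : (Fin m → ℝ) → ℝ) (hg : Measurable g) (d : ℕ) (C : ℝ) (hC1 : 0 ≤ C)
    (hC : ∀ θ, (∀ j, 0 ≤ θ j) → |g θ| ≤ C * (∑ j, θ j) ^ d) :
    IntegrableOn (fun θ : Fin m → ℝ =>
      (∏ j, θ j ^ (α j - 1) * Real.exp (-θ j) / Real.Gamma (α j)) * g θ) {θ | ∀ j, 0 ≤ θ j} := by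
  have hset : {θ : Fin m → ℝ | ∀ j, 0 ≤ θ j} = Set.univ.pi (fun _ => Set.Ici 0) := by
    ext; simp [Pi.le_def]
  have hms : MeasurableSet {θ : Fin m → ℝ | ∀ j, 0 ≤ θ j} := by
    rw [hset]; exact MeasurableSet.univ_pi fun _ => measurableSet_Ici
  have hI : IntegrableOn (fun θ : Fin m → ℝ =>
      (C * (2 ^ d * d.factorial)) * 
      ∏ j, (θ j ^ (α j - 1) * Real.exp (-(1/2) * θ j ^ (1:ℝ)) / Real.Gamma (α j)))
      {θ | ∀ j, 0 ≤ θ j} := by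
    refine Integrable.const_mul ?_ _
    rw [hset, volume_pi, Measure.restrict_pi_pi]
    refine Integrable.fintype_prod (f := fun j (t : ℝ) =>
      (t ^ (α j - 1) * Real.exp (-(1/2) * t ^ (1:ℝ)) / Real.Gamma (α j))) fun j => ?_
    refine Integrable.div_const ?_ _
    change IntegrableOn _ _ _
    rw [integrableOn_Ici_iff_integrableOn_Ioi]
    exact integrableOn_rpow_mul_exp_neg_mul_rpow (by linarith [hα j]) one_pos (by norm_num)
  refine Integrable.mono' hI (by fun_prop) ?_
  refine (ae_restrict_mem hms).mono fun θ hθ => ?_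
  have hS : 0 ≤ ∑ j, θ j := Finset.sum_nonneg fun j _ => hθ j
  have hC0 : 0 ≤ C * (∑ j, θ j) ^ d := (abs_nonneg _).trans (hC θ hθ)
  have hnn : 0 ≤ ∏ j, θ j ^ (α j - 1) * Real.exp (-θ j) / Real.Gamma (α j) :=
    Finset.prod_nonneg fun j _ => div_nonneg (mul_nonneg (Real.rpow_nonneg (hθ j) _)
      (Real.exp_nonneg _)) (Real.Gamma_pos_of_pos (hα j)).le
  rw [Real.norm_eq_abs, abs_mul, abs_of_nonneg hnn]
  have hexp : (∑ j, θ j) ^ d ≤ (2 ^ d * d.factorial) * ∏ j, Real.exp (θ j / 2) := by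
    have := Real.pow_div_factorial_le_exp ((∑ j, θ j)/2) (by positivity) d
    rw [← Real.exp_sum, ← Finset.sum_div]
    rw [div_le_iff₀ (by positivity), div_pow, div_le_iff₀ (by positivity)] at this
    linarith
  · calc _ ≤ (∏ j, θ j ^ (α j - 1) * Real.exp (-θ j) / Real.Gamma (α j)) *
          (C * ((2 ^ d * d.factorial) * ∏ j, Real.exp (θ j / 2))) :=
          mul_le_mul_of_nonneg_left ((hC θ hθ).trans
            (mul_le_mul_of_nonneg_left hexp hC1)) hnn
      _ = (C * (2 ^ d * d.factorial)) * ∏ j, ((θ j ^ (α j - 1) * Real.exp (-θ j) / Real.Gamma (α j))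
            * Real.exp (θ j / 2)) := by rw [Finset.prod_mul_distrib]; ring
      _ = _ := by
          congr 1
          refine Finset.prod_congr rfl fun j _ => ?_
          have : Real.exp (-(1/2) * θ j ^ (1:ℝ)) = Real.exp (-θ j) * Real.exp (θ j / 2) := by
            rw [← Real.exp_add, Real.rpow_one]; ring_nf
          rw [this]; ring

lemma aux_main (k : ℕ) (α : Fin (k+1) → ℝ) (hα : ∀ j, 0 < α j)
    (g : (Fin (k+1) → ℝ) → ℝ) (hg : Measurable g) (d : ℕ) (C : ℝ) (hC1 : 0 ≤ C)
    (hC : ∀ θ, (∀ j, 0 ≤ θ j) → |g θ| ≤ C * (∑ j, θ j) ^ d)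
    (hh : ∀ (s : ℝ) θ, g (s • θ) = s ^ d * g θ) :
    (∫ θ : Fin (k+1) → ℝ in {θ | ∀ j, 0 < θ j},
      (∏ j, θ j ^ (α j - 1) * Real.exp (-θ j) / Real.Gamma (α j)) * g θ) =
    Real.Gamma (∑ j, α j + d) / Real.Gamma (∑ j, α j) * dirExp (k+1) α g := by
  have ha : 0 < ∑ j, α j := Finset.sum_pos (fun j _ => hα j) Finset.univ_nonempty
  have hae : ({θ : Fin (k+1) → ℝ | ∀ j, 0 < θ j} : Set _) =ᵐ[volume]
      {θ : Fin (k+1) → ℝ | ∀ j, 0 ≤ θ j} := by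
    have := Measure.univ_pi_Ioi_ae_eq_Ici (μ := fun _ : Fin (k+1) => (volume : Measure ℝ))
      (f := fun _ => 0)
    have e1 : {θ : Fin (k+1) → ℝ | ∀ j, 0 < θ j} = Set.univ.pi fun _ => Set.Ioi 0 := by
      ext; simp [Set.mem_pi]
    have e2 : {θ : Fin (k+1) → ℝ | ∀ j, 0 ≤ θ j} = Set.Ici fun _ => 0 := by
      ext; simp [Pi.le_def]
    rw [e1, e2]
    exact this
  have hms : MeasurableSet {θ : Fin (k+1) → ℝ | ∀ j, 0 ≤ θ j} := by
    simp only [Set.ofPred_forall]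
    exact MeasurableSet.iInter fun j => measurableSet_le measurable_const (measurable_pi_apply j)
  have hint := aux_integrable (k+1) α hα g hg d C hC1 hC
  rw [setIntegral_congr_set hae, ← integral_indicator hms]
  rw [← integrable_indicator_iff hms] at hint
  set F : (Fin (k+1) → ℝ) → ℝ := Set.indicator {θ : Fin (k+1) → ℝ | ∀ j, 0 ≤ θ j} (fun θ =>
      (∏ j, θ j ^ (α j - 1) * Real.exp (-θ j) / Real.Gamma (α j)) * g θ) with hF
  have hmp := aux_mp k
  have hFi := hmp.integrable_comp_of_integrable hint
  rw [← hmp.map_eq, integral_map hmp.measurable.aemeasurable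
    (by rw [hmp.map_eq]; exact hint.aestronglyMeasurable)]
  refine (integral_prod_symm _ hFi).trans ?_
  simp only [Function.comp_apply]
  set D : ℝ := dirExp (k+1) α g with hD
  have hin : ∀ᵐ s : ℝ, (∫ y : Fin k → ℝ, F ((Fin.last k).insertNth (α := fun _ => ℝ)
        (s - ∑ j, y j) y)) = Set.indicator (Set.Ioi 0)
      (fun s => (Real.exp (-s) * s ^ (∑ j, α j + d - 1)) * (D / Real.Gamma (∑ j, α j))) s := by
    have h0 : ∀ᵐ s : ℝ, s ≠ 0 := by simp [ae_iff]
    filter_upwards [h0] with s hs0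
    rcases lt_or_gt_of_ne hs0 with hs | hs
    · rw [Set.indicator_of_notMem (by simp [hs.le])]
      rw [← integral_zero (Fin k → ℝ) ℝ (μ := volume)]
      congr 1; funext y
      rw [hF, Set.indicator_of_notMem]
      intro hy
      have h1 := Finset.sum_nonneg (s := Finset.univ) fun j _ => hy j
      rw [Fin.sum_univ_castSucc] at h1
      simp at h1
      linarith
    · rw [Set.indicator_of_mem (by exact hs)]
      have hsc := Measure.integral_comp_smul (volume : Measure (Fin k → ℝ)) (fun y => 
        F ((Fin.last k).insertNth (α := fun _ => ℝ) (s - ∑ j, y j) y)) s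
      have hsk : 0 < s ^ k := pow_pos hs k
      rw [Module.finrank_fin_fun, abs_of_pos (inv_pos.2 hsk), smul_eq_mul, eq_comm,
        inv_mul_eq_iff_eq_mul₀ hsk.ne'] at hsc
      rw [hsc]
      have hx : ∀ x : Fin k → ℝ, F ((Fin.last k).insertNth (α := fun _ => ℝ)
          (s - ∑ j, (s • x) j) (s • x)) =
          (Real.exp (-s) * s ^ (∑ j, α j + d - 1 - k) / Real.Gamma (∑ j, α j)) *
          Set.indicator (simplexDom (k+1)) (fun x => g (coordMap (k+1) x) *
            (∏ j, (coordMap (k+1) x) j ^ (α j - 1)) /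
            ((∏ j, Real.Gamma (α j)) / Real.Gamma (∑ j, α j))) x := by
        intro x
        rw [aux_coord]
        have hmem : (∀ j, 0 ≤ (s • coordMap (k+1) x) j) ↔ x ∈ simplexDom (k+1) := by
          simp only [Pi.smul_apply, smul_eq_mul, mul_nonneg_iff_of_pos_left hs]
          rw [Fin.forall_fin_succ']
          simp [coordMap, simplexDom]
        by_cases hxm : x ∈ simplexDom (k+1)
        · rw [Set.indicator_of_mem hxm, hF, Set.indicator_of_mem (by exact hmem.2 hxm)]
          have hpos : ∀ j, 0 ≤ coordMap (k+1) x j := fun j => by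
            have := hmem.2 hxm j
            simpa [mul_nonneg_iff_of_pos_left hs] using this
          have hsum : ∑ j, coordMap (k+1) x j = 1 := by
            rw [Fin.sum_univ_castSucc]
            simp [coordMap]
          rw [hh]
          simp only [Pi.smul_apply, smul_eq_mul]
          rw [Finset.prod_div_distrib, Finset.prod_mul_distrib, ← Real.exp_sum,
            Finset.sum_neg_distrib, ← Finset.mul_sum, hsum, mul_one]
          have e1 : ∏ j, (s * coordMap (k+1) x j) ^ (α j - 1) =
              s ^ (∑ j, α j - (k + 1)) * ∏ j, coordMap (k+1) x j ^ (α j - 1) := by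
            rw [Finset.prod_congr rfl fun j _ => Real.mul_rpow hs.le (hpos j),
              Finset.prod_mul_distrib, ← Real.rpow_sum_of_pos hs]
            simp
          have e2 : s ^ (∑ j, α j + d - 1 - k) = s ^ (∑ j, α j - (k + 1)) * s ^ d := by
            rw [← Real.rpow_add_natCast hs.ne']; congr 1; ring
          rw [e1, e2]
          have hG := (Real.Gamma_pos_of_pos ha).ne'
          have hG2 : (∏ j, Real.Gamma (α j)) ≠ 0 :=
            Finset.prod_ne_zero_iff.2 fun j _ => (Real.Gamma_pos_of_pos (hα j)).ne'
          field_simp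
        · rw [Set.indicator_of_notMem hxm, hF, Set.indicator_of_notMem, mul_zero]
          exact fun h => hxm (hmem.1 h)
      simp_rw [hx]
      have hsm : MeasurableSet (simplexDom (k+1)) := by
        have : simplexDom (k+1) = {x | ∀ j, 0 ≤ x j} ∩ {x | ∑ j, x j ≤ 1} := rfl
        rw [this]
        refine MeasurableSet.inter ?_ (measurableSet_le (by fun_prop) measurable_const)
        simp only [Set.ofPred_forall]
        exact MeasurableSet.iInter fun j =>
          measurableSet_le measurable_const (measurable_pi_apply j)
      have hDi : (∫ a : Fin k → ℝ, Set.indicator (simplexDom (k+1)) (fun x =>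
            g (coordMap (k+1) x) * (∏ j, (coordMap (k+1) x) j ^ (α j - 1)) /
            ((∏ j, Real.Gamma (α j)) / Real.Gamma (∑ j, α j))) a) = D :=
        integral_indicator hsm
      rw [integral_const_mul, hDi]
      have e3 : s ^ (∑ j, α j + d - 1) = s ^ (∑ j, α j + d - 1 - k) * s ^ k := by
        rw [← Real.rpow_add_natCast hs.ne']; congr 1; ring
      rw [e3]
      ring
  rw [integral_congr_ae hin, integral_indicator measurableSet_Ioi, integral_mul_const,
    ← Real.Gamma_eq_integral (by positivity)]
  ring

theorem posterior_mean_eq_gamma_ratio (n m : ℕ) (hn : 1 ≤ n) (hm : 1 ≤ m)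
    (α : Fin m → ℝ) (hα : ∀ j, 0 < α j) (β : Fin n → Fin m → ℝ)
    (hp : ptilde n m α β Finset.univ ≠ 0) (z : Fin m) :
    dirExp m α (fun θ => θ z * ∏ i : Fin n, ∑ j, β i j * θ j) /
        dirExp m α (fun θ => ∏ i : Fin n, ∑ j, β i j * θ j)
      = (1 / ((∑ j, α j) + n)) *
          ((∫ θ : Fin m → ℝ in {θ | ∀ j, 0 < θ j},
              (∏ j, θ j ^ (α j - 1) * Real.exp (-θ j) / Real.Gamma (α j)) *
                (θ z * ∏ i, (∑ j, β i j * θ j))) /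
            ptilde n m α β Finset.univ) := by
  obtain ⟨k, rfl⟩ : ∃ k, m = k + 1 := ⟨m - 1, by omega⟩
  have hb : ∀ θ : Fin (k+1) → ℝ, (∀ j, 0 ≤ θ j) → |∏ i : Fin n, ∑ j, β i j * θ j| ≤
      (∏ i : Fin n, ∑ j, |β i j|) * (∑ j, θ j) ^ n := by
    intro θ hθ
    rw [Finset.abs_prod]
    calc _ ≤ ∏ i : Fin n, ((∑ j, |β i j|) * ∑ j, θ j) := by
          refine Finset.prod_le_prod (fun _ _ => abs_nonneg _) fun i _ => ?_
          refine (Finset.abs_sum_le_sum_abs _ _).trans ?_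
          rw [Finset.sum_mul]
          refine Finset.sum_le_sum fun j _ => ?_
          rw [abs_mul, abs_of_nonneg (hθ j)]
          exact mul_le_mul_of_nonneg_left
            (Finset.single_le_sum (fun j _ => hθ j) (Finset.mem_univ j)) (abs_nonneg _)
      _ = _ := by simp [Finset.prod_mul_distrib]
  have hhom : ∀ (s : ℝ) (θ : Fin (k+1) → ℝ), (∏ i : Fin n, ∑ j, β i j * (s • θ) j) =
      s ^ n * ∏ i : Fin n, ∑ j, β i j * θ j := by
    intro s θ
    have : ∀ i, ∑ j, β i j * (s • θ) j = s * ∑ j, β i j * θ j := fun i => by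
      rw [Finset.mul_sum]; refine Finset.sum_congr rfl fun j _ => ?_
      simp; ring
    simp_rw [this, Finset.prod_mul_distrib]
    simp
  have hC0 : 0 ≤ ∏ i : Fin n, ∑ j, |β i j| :=
    Finset.prod_nonneg fun i _ => Finset.sum_nonneg fun j _ => abs_nonneg _
  have h1 := aux_main k α hα (fun θ => ∏ i : Fin n, ∑ j, β i j * θ j) (by fun_prop) n _ hC0 hb hhom
  have h2 := aux_main k α hα (fun θ => θ z * ∏ i : Fin n, ∑ j, β i j * θ j) (by fun_prop) (n+1)
    (∏ i : Fin n, ∑ j, |β i j|) hC0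
    (by
      intro θ hθ
      rw [abs_mul, abs_of_nonneg (hθ z), pow_succ']
      have := mul_le_mul (Finset.single_le_sum (fun j _ => hθ j) (Finset.mem_univ z)) (hb θ hθ)
        (abs_nonneg _) (Finset.sum_nonneg fun j _ => hθ j)
      linarith)
    (by
      intro s θ
      simp only [hhom, pow_succ']
      simp; ring)
  have ha : 0 < ∑ j, α j := Finset.sum_pos (fun j _ => hα j) Finset.univ_nonempty
  have han : 0 < ∑ j, α j + n := by positivity
  rw [h2]
  unfold ptilde
  rw [h1]
  have hG : Real.Gamma (∑ j, α j + (n + 1 : ℕ)) = (∑ j, α j + n) * Real.Gamma (∑ j, α j + n) := by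
    rw [← Real.Gamma_add_one han.ne']; push_cast; ring_nf
  rw [hG]
  have g1 := (Real.Gamma_pos_of_pos ha).ne'
  have g2 := (Real.Gamma_pos_of_pos han).ne'
  rw [mul_div_assoc (∑ j, α j + (n : ℝ)), mul_assoc (∑ j, α j + (n : ℝ)),
    mul_div_assoc (∑ j, α j + (n : ℝ)), mul_div_mul_left _ _ (div_ne_zero g2 g1), ← mul_assoc,
    one_div, inv_mul_cancel₀ han.ne', one_mul]
end

section
/- Let m ≥ 2, fix z₀ ∈ Fin m, and let p̃' denote the unnormalized probability computed with the cause z₀ deleted (i.e. all sums over causes range over j ∈ Fin m, j ≠ z₀). Then for every subset K ⊆ Fin n, p̃(K) = ∑_{I ⊆ K} (α_{z₀})_{|I|} · (∏_{i∈I} β i z₀) · p̃'(K ∖ I). -/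
open MeasureTheory Real Finset

/-- The unnormalized probability `p̃'(K)` computed with the cause `z₀` deleted. -/
noncomputable def ptildeDel (n m : ℕ) (α : Fin m → ℝ) (β : Fin n → Fin m → ℝ)
    (z₀ : Fin m) (K : Finset (Fin n)) : ℝ :=
  ∫ θ : {j : Fin m // j ≠ z₀} → ℝ in {θ | ∀ j, 0 < θ j},
    (∏ j, θ j ^ (α j.1 - 1) * Real.exp (-θ j) / Real.Gamma (α j.1)) *
      ∏ i ∈ K, (∑ j, β i j.1 * θ j)

lemma orthant_restrict {ι : Type*} [Fintype ι] :
    (volume : Measure (ι → ℝ)).restrict {θ | ∀ j, 0 < θ j}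
      = Measure.pi (fun _ : ι => (volume : Measure ℝ).restrict (Set.Ioi 0)) := by
  rw [← Measure.restrict_pi_pi]
  congr 1
  ext θ
  simp

lemma weight_eq {a : ℝ} (k : ℕ) {x : ℝ} (hx : 0 < x) :
    x ^ (a - 1) * Real.exp (-x) / Real.Gamma a * x ^ k
      = (Real.Gamma a)⁻¹ * (Real.exp (-x) * x ^ (a + k - 1)) := by
  have : x ^ (a + k - 1) = x ^ (a - 1) * x ^ k := by
    rw [← Real.rpow_add_natCast hx.ne']
    congr 1
    ring
  rw [this]
  ring

lemma weight_integrable {a : ℝ} (ha : 0 < a) (k : ℕ) :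
    Integrable (fun x : ℝ => x ^ (a - 1) * Real.exp (-x) / Real.Gamma a * x ^ k)
      ((volume : Measure ℝ).restrict (Set.Ioi 0)) := by
  have h := (Real.GammaIntegral_convergent (s := a + k) (by positivity)).const_mul
    (Real.Gamma a)⁻¹
  refine h.congr ?_
  filter_upwards [ae_restrict_mem measurableSet_Ioi] with x hx
  exact (weight_eq k hx).symm

lemma gamma_poch {a : ℝ} (ha : 0 < a) (k : ℕ) :
    Real.Gamma (a + k) = (ascPochhammer ℝ k).eval a * Real.Gamma a := by
  induction k with
  | zero => simp
  | succ k ih =>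
    rw [ascPochhammer_succ_eval, Nat.cast_succ, ← add_assoc, Real.Gamma_add_one (by positivity), ih]
    ring

lemma weight_integral {a : ℝ} (ha : 0 < a) (k : ℕ) :
    ∫ x in Set.Ioi (0 : ℝ), x ^ (a - 1) * Real.exp (-x) / Real.Gamma a * x ^ k
      = (ascPochhammer ℝ k).eval a := by
  rw [setIntegral_congr_fun measurableSet_Ioi (fun x hx => weight_eq k hx),
    integral_const_mul, ← Real.Gamma_eq_integral (by positivity), gamma_poch ha]
  have := (Real.Gamma_pos_of_pos ha).ne'
  field_simp

lemma full_integrable {ι κ : Type*} [Fintype ι] (α : ι → ℝ) (hα : ∀ j, 0 < α j)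
    (β : κ → ι → ℝ) (K : Finset κ) : ∀ k : ι → ℕ,
    Integrable (fun θ : ι → ℝ =>
      (∏ j, (θ j ^ (α j - 1) * Real.exp (-θ j) / Real.Gamma (α j) * θ j ^ k j)) *
        ∏ i ∈ K, (∑ j, β i j * θ j))
      (Measure.pi (fun _ : ι => (volume : Measure ℝ).restrict (Set.Ioi 0))) := by
  classical
  induction K using Finset.induction_on with
  | empty =>
    intro k
    simp only [Finset.prod_empty, mul_one]
    exact Integrable.fintype_prod (f := fun j (x : ℝ) =>
      x ^ (α j - 1) * Real.exp (-x) / Real.Gamma (α j) * x ^ k j)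
      (fun j => weight_integrable (hα j) (k j))
  | insert i K hi ih =>
    intro k
    have h : Integrable (fun θ : ι → ℝ => ∑ l, β i l *
      ((∏ j, (θ j ^ (α j - 1) * Real.exp (-θ j) / Real.Gamma (α j) *
        θ j ^ (k + Pi.single l 1 : ι → ℕ) j)) *
        ∏ i ∈ K, (∑ j, β i j * θ j)))
      (Measure.pi (fun _ : ι => (volume : Measure ℝ).restrict (Set.Ioi 0))) :=
      integrable_finsetSum _ (fun l _ => (ih (k + Pi.single l 1)).const_mul (β i l))
    refine h.congr (Filter.Eventually.of_forall fun θ => ?_)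
    have hs : ∀ l, (∏ j, (θ j ^ (α j - 1) * Real.exp (-θ j) / Real.Gamma (α j) *
        θ j ^ (k + Pi.single l 1 : ι → ℕ) j)) = (∏ j, (θ j ^ (α j - 1) * Real.exp (-θ j) /
          Real.Gamma (α j) * θ j ^ k j)) * θ l := by
      intro l
      simp only [Pi.add_apply, pow_add, ← mul_assoc]
      rw [Finset.prod_mul_distrib]
      congr 1
      rw [Finset.prod_eq_single l]
      · simp
      · intro b _ hb
        simp [Pi.single_eq_of_ne hb]
      · simp
    simp only [hs]
    rw [Finset.prod_insert hi, Finset.sum_mul, Finset.mul_sum]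
    refine Finset.sum_congr rfl fun l _ => ?_
    ring

theorem ptilde_delete_cause (n m : ℕ) (hn : 1 ≤ n) (hm : 2 ≤ m)
    (α : Fin m → ℝ) (hα : ∀ j, 0 < α j) (β : Fin n → Fin m → ℝ)
    (z₀ : Fin m) (K : Finset (Fin n)) :
    ptilde n m α β K
      = ∑ I ∈ K.powerset,
          (ascPochhammer ℝ I.card).eval (α z₀) * (∏ i ∈ I, β i z₀) *
            ptildeDel n m α β z₀ (K \ I) := by
  classical
  set μ : Measure ℝ := (volume : Measure ℝ).restrict (Set.Ioi 0) with hμ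
  let e := MeasurableEquiv.piEquivPiSubtypeProd (fun _ : Fin m => ℝ) (fun j => j = z₀)
  have he : MeasurePreserving e (Measure.pi fun _ => μ)
      ((Measure.pi fun _ => μ).prod (Measure.pi fun _ => μ)) := by
    convert measurePreserving_piEquivPiSubtypeProd (fun _ : Fin m => μ) (fun j => j = z₀)
  let F : Finset (Fin n) → ({j : Fin m // j = z₀} → ℝ) → ℝ := fun I x =>
    x ⟨z₀, rfl⟩ ^ (α z₀ - 1) * Real.exp (-x ⟨z₀, rfl⟩) / Real.Gamma (α z₀) *
      x ⟨z₀, rfl⟩ ^ I.card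
  let G : Finset (Fin n) → ({j : Fin m // j ≠ z₀} → ℝ) → ℝ := fun J θ =>
    (∏ j, θ j ^ (α j.1 - 1) * Real.exp (-θ j) / Real.Gamma (α j.1)) *
      ∏ i ∈ J, (∑ j, β i j.1 * θ j)
  have hu := measurePreserving_funUnique μ {j : Fin m // j = z₀}
  have hFi : ∀ I, Integrable (F I) (Measure.pi fun _ => μ) := fun I =>
    hu.integrable_comp_of_integrable (weight_integrable (hα z₀) I.card)
  have hF : ∀ I, ∫ x, F I x ∂(Measure.pi fun _ => μ) = (ascPochhammer ℝ I.card).eval (α z₀) := by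
    intro I
    rw [← weight_integral (hα z₀) I.card]
    exact hu.integral_comp' (fun x : ℝ =>
      x ^ (α z₀ - 1) * Real.exp (-x) / Real.Gamma (α z₀) * x ^ I.card)
  have hGi : ∀ J, Integrable (G J) (Measure.pi fun _ => μ) := by
    intro J
    have := full_integrable (fun j : {j : Fin m // j ≠ z₀} => α j.1) (fun j => hα j.1)
      (fun i j => β i j.1) J 0
    simpa only [Pi.zero_apply, pow_zero, mul_one] using this
  have hG : ∀ J, ptildeDel n m α β z₀ J = ∫ x, G J x ∂(Measure.pi fun _ => μ) := by
    intro J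
    rw [ptildeDel, orthant_restrict]
  have key : ∀ θ : Fin m → ℝ,
      (∏ j, θ j ^ (α j - 1) * Real.exp (-θ j) / Real.Gamma (α j)) *
        ∏ i ∈ K, (∑ j, β i j * θ j)
      = ∑ I ∈ K.powerset, (∏ i ∈ I, β i z₀) * (F I (e θ).1 * G (K \ I) (e θ).2) := by
    intro θ
    simp only [Fintype.sum_eq_add_sum_subtype_ne _ z₀, Fintype.prod_eq_mul_prod_subtype_ne _ z₀]
    rw [Finset.prod_add, Finset.mul_sum]
    refine Finset.sum_congr rfl fun I _ => ?_
    rw [Finset.prod_mul_distrib, Finset.prod_const]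
    change _ = (∏ i ∈ I, β i z₀) * ((θ z₀ ^ (α z₀ - 1) * Real.exp (-θ z₀) / Real.Gamma (α z₀) *
      θ z₀ ^ I.card) * ((∏ j : {j : Fin m // j ≠ z₀}, θ j ^ (α j.1 - 1) * Real.exp (-θ j) /
        Real.Gamma (α j.1)) * ∏ i ∈ K \ I, (∑ j : {j : Fin m // j ≠ z₀}, β i j.1 * θ j)))
    ring
  rw [ptilde, orthant_restrict]
  simp only [key]
  rw [he.integral_comp' (fun y => ∑ I ∈ K.powerset,
    (∏ i ∈ I, β i z₀) * (F I y.1 * G (K \ I) y.2)), integral_finsetSum]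
  · refine Finset.sum_congr rfl fun I _ => ?_
    rw [integral_const_mul, integral_prod_mul, hF, hG]
    ring
  · intro I _
    exact ((hFi I).mul_prod (hGi (K \ I))).const_mul _
end
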